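/- arXiv:1407.2479 — 3 statements merged into one kernel-verified Lean document; each statement's English description precedes it below -/
import Mathlib

section
/- Let D be an MHR value distribution with revenue curve R(q) = q·v(q) and monopoly quantile q* (the maximizer of R over [0,1]). Then for every q' with 0 ≤ q' ≤ 1, one has R(q*) − R(q') ≥ (1/4)·(q* − q')²·R(q*). -/
open MeasureTheory Set

/-- A value distribution on `[0,∞)` with CDF `F`, density `f` (w.r.t. Lebesgue measure),
whose support is an interval contained in `[0,∞)`. -/
structure ValueDist where
  μ : Measure ℝ
  isProb : IsProbabilityMeasure μ
  f : ℝ → ℝ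
  f_nonneg : ∀ x, 0 ≤ f x
  f_meas : Measurable f
  density_eq : μ = volume.withDensity fun x => ENNReal.ofReal (f x)
  supp : Set ℝ
  supp_subset : supp ⊆ Ici 0
  supp_conn : supp.OrdConnected
  f_pos : ∀ x ∈ supp, 0 < f x
  f_zero : ∀ x ∉ supp, f x = 0

/-- The CDF of a value distribution. -/
noncomputable def ValueDist.F (D : ValueDist) (x : ℝ) : ℝ := (D.μ (Iic x)).toReal

/-- The virtual value function `φ(v) = v - (1 - F v) / f v`. -/
noncomputable def ValueDist.phi (D : ValueDist) (x : ℝ) : ℝ := x - (1 - D.F x) / D.f x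

/-- Monotone hazard rate: the virtual value satisfies `dφ/dv ≥ 1` throughout the support. -/
def ValueDist.IsMHR (D : ValueDist) : Prop :=
  ∀ x ∈ D.supp, ∃ d : ℝ, 1 ≤ d ∧ HasDerivWithinAt D.phi d D.supp x


namespace ValueDist

lemma integrable_f (D : ValueDist) : Integrable D.f volume := by
  refine ⟨D.f_meas.aestronglyMeasurable, ?_⟩
  rw [hasFiniteIntegral_iff_ofReal (Filter.Eventually.of_forall D.f_nonneg)]
  have h1 : D.μ univ = 1 := D.isProb.measure_univ
  rw [D.density_eq, withDensity_apply _ MeasurableSet.univ, Measure.restrict_univ] at h1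
  rw [h1]; exact ENNReal.one_lt_top

lemma F_eq (D : ValueDist) (x : ℝ) : D.F x = ∫ t in Iic x, D.f t := by
  unfold ValueDist.F
  rw [D.density_eq, withDensity_apply _ measurableSet_Iic,
    integral_eq_lintegral_of_nonneg_ae (Filter.Eventually.of_forall D.f_nonneg)
      D.f_meas.aestronglyMeasurable]

lemma F_sub (D : ValueDist) (a x : ℝ) : D.F x = D.F a + ∫ t in a..x, D.f t := by
  rw [F_eq, F_eq, ← intervalIntegral.integral_Iic_sub_Iic D.integrable_f.integrableOn
    D.integrable_f.integrableOn]
  ring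

lemma F_cont (D : ValueDist) : Continuous D.F := by
  have : D.F = fun x => D.F 0 + ∫ t in (0:ℝ)..x, D.f t := funext fun x => D.F_sub 0 x
  rw [this]
  exact continuous_const.add
    (intervalIntegral.continuous_primitive (fun a b => D.integrable_f.intervalIntegrable) 0)

lemma F_lt (D : ValueDist) {a b : ℝ} (ha : a ∈ D.supp) (hb : b ∈ D.supp) (h : a < b) :
    D.F a < D.F b := by
  rw [D.F_sub a b]
  have := intervalIntegral.intervalIntegral_pos_of_pos_on
    (D.integrable_f.intervalIntegrable (a := a) (b := b))
    (fun x hx => D.f_pos x (D.supp_conn.out ha hb ⟨hx.1.le, hx.2.le⟩)) h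
  linarith

lemma F_inj (D : ValueDist) {a b : ℝ} (ha : a ∈ D.supp) (hb : b ∈ D.supp)
    (h : D.F a = D.F b) : a = b := by
  rcases lt_trichotomy a b with h1 | h1 | h1
  · exact absurd h (D.F_lt ha hb h1).ne
  · exact h1
  · exact absurd h (D.F_lt hb ha h1).ne'

lemma F_mono (D : ValueDist) : Monotone D.F := by
  intro a b h
  rw [D.F_sub a b]
  have := intervalIntegral.integral_nonneg (μ := volume) h (fun x _ => D.f_nonneg x)
  linarith

lemma hasDerivAt_F (D : ValueDist) (hM : D.IsMHR) {a b x : ℝ} (ha : a ∈ D.supp)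
    (hb : b ∈ D.supp) (hx : x ∈ Ioo a b) (hS : 0 < 1 - D.F x) :
    HasDerivAt D.F (D.f x) x := by
  have hsub : Icc a b ⊆ D.supp := D.supp_conn.out ha hb
  have hn : D.supp ∈ nhds x := Filter.mem_of_superset (Icc_mem_nhds hx.1 hx.2) hsub
  have hxs : x ∈ D.supp := hsub ⟨hx.1.le, hx.2.le⟩
  obtain ⟨d, -, hd⟩ := hM x hxs
  have hphi : ContinuousAt D.phi x := (hd.hasDerivAt hn).continuousAt
  have hfx := D.f_pos x hxs
  have hc : ContinuousAt (fun y => (1 - D.F y) / (y - D.phi y)) x := by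
    refine ContinuousAt.div (continuousAt_const.sub D.F_cont.continuousAt)
      (continuousAt_id.sub hphi) ?_
    have : x - D.phi x = (1 - D.F x) / D.f x := by unfold ValueDist.phi; ring
    rw [this]; positivity
  have hSe : ∀ᶠ y in nhds x, 0 < 1 - D.F y :=
    (continuous_const.sub D.F_cont).continuousAt.eventually (lt_mem_nhds hS)
  have hcf : ContinuousAt D.f x := by
    refine hc.congr ?_
    filter_upwards [hn, hSe] with y hy hSy
    have hfy := D.f_pos y hy
    have : y - D.phi y = (1 - D.F y) / D.f y := by unfold ValueDist.phi; ring
    rw [this]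
    field_simp
  have hE : D.F = fun y => D.F a + ∫ t in a..y, D.f t := funext fun y => D.F_sub a y
  rw [hE]
  exact (intervalIntegral.integral_hasDerivAt_right D.integrable_f.intervalIntegrable
    D.f_meas.stronglyMeasurable.stronglyMeasurableAtFilter hcf).const_add _

lemma psi_anti (D : ValueDist) (hM : D.IsMHR) {x y : ℝ} (hx : x ∈ D.supp) (hy : y ∈ D.supp)
    (h : x ≤ y) : (1 - D.F y) / D.f y ≤ (1 - D.F x) / D.f x := by
  have hsub : Icc x y ⊆ D.supp := D.supp_conn.out hx hy
  have hmono : MonotoneOn (fun t => D.phi t - t) (Icc x y) := by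
    have hder : ∀ t ∈ Ioo x y, ∃ d : ℝ, 1 ≤ d ∧ HasDerivAt D.phi d t := by
      intro t ht
      obtain ⟨d, h1, hd⟩ := hM t (hsub ⟨ht.1.le, ht.2.le⟩)
      exact ⟨d, h1, hd.hasDerivAt (Filter.mem_of_superset (Icc_mem_nhds ht.1 ht.2) hsub)⟩
    refine monotoneOn_of_deriv_nonneg (convex_Icc x y) ?_ ?_ ?_
    · intro t ht
      obtain ⟨d, h1, hd⟩ := hM t (hsub ht)
      exact (hd.continuousWithinAt.mono hsub).sub continuousWithinAt_id
    · intro t ht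
      rw [interior_Icc] at ht
      obtain ⟨d, h1, hd⟩ := hder t ht
      exact (hd.sub (hasDerivAt_id t)).differentiableAt.differentiableWithinAt
    · intro t ht
      rw [interior_Icc] at ht
      obtain ⟨d, h1, hd⟩ := hder t ht
      have := (hd.sub (hasDerivAt_id t)).deriv
      have h2 : deriv (fun t => D.phi t - t) t = d - 1 := this
      rw [h2]; linarith
  have := hmono (left_mem_Icc.2 h) (right_mem_Icc.2 h) h
  simp only [ValueDist.phi] at this
  linarith

lemma convex_G (D : ValueDist) (hM : D.IsMHR) {a b : ℝ} (ha : a ∈ D.supp)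
    (hb : b ∈ D.supp) (hS : 0 < 1 - D.F b) :
    ConvexOn ℝ (Icc a b) (fun x => - Real.log (1 - D.F x)) := by
  have hsub : Icc a b ⊆ D.supp := D.supp_conn.out ha hb
  have hpos : ∀ x ∈ Icc a b, 0 < 1 - D.F x := fun x hx => by
    have := D.F_mono hx.2; linarith
  have hder : ∀ x ∈ Ioo a b, HasDerivAt (fun x => - Real.log (1 - D.F x))
      (D.f x / (1 - D.F x)) x := by
    intro x hx
    have hp := hpos x ⟨hx.1.le, hx.2.le⟩
    have := (((D.hasDerivAt_F hM ha hb hx hp).const_sub 1).log hp.ne').neg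
    exact this.congr_deriv (by rw [neg_div, neg_neg])
  refine MonotoneOn.convexOn_of_deriv (convex_Icc a b) ?_ ?_ ?_
  · exact ((continuous_const.sub D.F_cont).continuousOn.log (fun x hx => (hpos x hx).ne')).neg
  · intro x hx
    rw [interior_Icc] at hx
    exact (hder x hx).differentiableAt.differentiableWithinAt
  · intro x hx y hy hxy
    rw [interior_Icc] at hx hy
    rw [(hder x hx).deriv, (hder y hy).deriv]
    have hx' : x ∈ Icc a b := ⟨hx.1.le, hx.2.le⟩
    have hy' : y ∈ Icc a b := ⟨hy.1.le, hy.2.le⟩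
    have h := D.psi_anti hM (hsub hx') (hsub hy') hxy
    have h1 := hpos x hx'
    have h2 := hpos y hy'
    have h3 := D.f_pos x (hsub hx')
    have h4 := D.f_pos y (hsub hy')
    rw [div_le_div_iff₀ h4 h3] at h
    rw [div_le_div_iff₀ h1 h2]
    linarith

end ValueDist

lemma final_ineq {q y L : ℝ} (hq : 0 < q) (hq1 : q ≤ 1) (hy : 0 < y) (hy1 : y ≤ 1)
    (hL : L = Real.log q - Real.log y) :
    1/4 * (q - y)^2 * q ≤ q - y * (1 + L) := by
  obtain ⟨a, ha, rfl⟩ : ∃ a, 0 < a ∧ q = a^2 :=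
    ⟨√q, Real.sqrt_pos.2 hq, (Real.sq_sqrt hq.le).symm⟩
  obtain ⟨b, hb, rfl⟩ : ∃ b, 0 < b ∧ y = b^2 :=
    ⟨√y, Real.sqrt_pos.2 hy, (Real.sq_sqrt hy.le).symm⟩
  have ha1 : a ≤ 1 := by nlinarith
  have hb1 : b ≤ 1 := by nlinarith
  have h1 : L ≤ 2 * (a / b - 1) := by
    have := Real.log_le_sub_one_of_pos (div_pos ha hb)
    rw [Real.log_div ha.ne' hb.ne'] at this
    rw [hL, Real.log_pow, Real.log_pow]
    push_cast
    linarith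
  have h2 : b^2 * L ≤ 2 * b * (a - b) := by
    calc b^2 * L ≤ b^2 * (2 * (a / b - 1)) := by gcongr
      _ = _ := by field_simp
  have h3 : (a + b)^2 * a^2 ≤ 4 * 1 := by
    apply mul_le_mul <;> nlinarith
  have h4 := mul_le_mul_of_nonneg_left h3 (sq_nonneg (a - b))
  nlinarith

theorem mhr_quadratic_revenue_loss (D : ValueDist) (hMHR : D.IsMHR)
    (v : ℝ → ℝ)
    (hv : ∀ q ∈ Ioc (0:ℝ) 1, v q ∈ D.supp ∧ 1 - D.F (v q) = q)
    (qs : ℝ) (hqs : qs ∈ Icc (0:ℝ) 1)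
    (hmax : ∀ q ∈ Icc (0:ℝ) 1, q * v q ≤ qs * v qs) :
    ∀ q' ∈ Icc (0:ℝ) 1,
      qs * v qs - q' * v q' ≥ 1/4 * (qs - q')^2 * (qs * v qs) := by
  intro y hy
  have hm := hmax y hy
  rcases hqs.1.eq_or_lt with h0 | hq0
  · rw [← h0] at hm ⊢
    simp only [zero_mul, mul_zero] at hm ⊢
    linarith
  obtain ⟨hXs, hXF⟩ := hv qs ⟨hq0, hqs.2⟩
  have hX0 : 0 ≤ v qs := D.supp_subset hXs
  rcases hX0.eq_or_lt with h0 | hX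
  · rw [← h0] at hm ⊢
    simp only [mul_zero] at hm ⊢
    linarith
  have hR : 0 < qs * v qs := mul_pos hq0 hX
  rcases hy.1.eq_or_lt with h0 | hy0
  · rw [← h0]
    have : qs^2 ≤ 1 := by nlinarith [hqs.2]
    nlinarith
  obtain ⟨hYs, hYF⟩ := hv y ⟨hy0, hy.2⟩
  set X := v qs with hXdef
  set Y := v y with hYdef
  have hY0 : 0 ≤ Y := D.supp_subset hYs
  set δ := (Y - X) / X with hδ
  set L := Real.log qs - Real.log y with hL
  -- convexity on the hull
  have hconv : ∃ a b, X ∈ Icc a b ∧ Y ∈ Icc a b ∧ a ∈ D.supp ∧ b ∈ D.supp ∧ 0 < 1 - D.F b := by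
    rcases le_total X Y with h | h
    · exact ⟨X, Y, ⟨le_rfl, h⟩, ⟨h, le_rfl⟩, hXs, hYs, by rw [hYF]; exact hy0⟩
    · exact ⟨Y, X, ⟨h, le_rfl⟩, ⟨le_rfl, h⟩, hYs, hXs, by rw [hXF]; exact hq0⟩
  obtain ⟨a, b, hXab, hYab, has, hbs, hbS⟩ := hconv
  have hG := D.convex_G hMHR has hbs hbS
  have key : ∀ l ∈ Ioo (0:ℝ) 1, δ / (1 + l * δ) ≤ L := by
    intro l hl
    have hl1 : 0 < 1 - l := by linarith [hl.2]
    set Z := (1 - l) * X + l * Y with hZ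
    have hZab : Z ∈ Icc a b := by
      have := hG.1 hXab hYab hl1.le hl.1.le (by ring)
      simpa [smul_eq_mul] using this
    have hZs : Z ∈ D.supp := D.supp_conn.out has hbs hZab
    have hZpos : 0 < Z := by
      have := mul_pos hl1 hX
      have := mul_nonneg hl.1.le hY0
      linarith
    have hSZ : 0 < 1 - D.F Z := by
      have := D.F_mono hZab.2; linarith
    have hSZ1 : 1 - D.F Z ≤ 1 := by
      have : 0 ≤ D.F Z := ENNReal.toReal_nonneg
      linarith
    obtain ⟨h1, h2⟩ := hv _ ⟨hSZ, hSZ1⟩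
    have hvZ : v (1 - D.F Z) = Z := D.F_inj h1 hZs (by linarith)
    have h3 := hmax _ ⟨hSZ.le, hSZ1⟩
    rw [hvZ] at h3
    have h4 := Real.log_le_log (mul_pos hSZ hZpos) h3
    rw [Real.log_mul hSZ.ne' hZpos.ne', Real.log_mul hq0.ne' hX.ne'] at h4
    have h5 := hG.2 hXab hYab hl1.le hl.1.le (by ring)
    simp only [smul_eq_mul] at h5
    rw [← hZ, hXF, hYF] at h5
    have hZX : Z / X = 1 + l * δ := by rw [hZ, hδ]; field_simp; ring
    have hpos : 0 < 1 + l * δ := by rw [← hZX]; positivity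
    have h6 := Real.one_sub_inv_le_log_of_pos hpos
    have h7 : Real.log (1 + l * δ) = Real.log Z - Real.log X := by
      rw [← hZX, Real.log_div hZpos.ne' hX.ne']
    have h8 : 1 - (1 + l * δ)⁻¹ = l * (δ / (1 + l * δ)) := by field_simp; ring
    have h9 : l * (δ / (1 + l * δ)) ≤ l * L := by
      rw [← h8, hL]; nlinarith
    exact le_of_mul_le_mul_left h9 hl.1
  have hδL : δ ≤ L := by
    have hc : ContinuousAt (fun l : ℝ => δ / (1 + l * δ)) 0 := by
      refine ContinuousAt.div continuousAt_const (by fun_prop) (by simp)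
    have ht : Filter.Tendsto (fun l : ℝ => δ / (1 + l * δ)) (nhdsWithin 0 (Ioi 0)) (nhds δ) := by
      have := hc.tendsto.mono_left (nhdsWithin_le_nhds (s := Ioi (0:ℝ)))
      simpa using this
    refine le_of_tendsto ht ?_
    filter_upwards [Ioo_mem_nhdsGT (zero_lt_one' ℝ)] with l hl using key l hl
  have hYle : Y ≤ X * (1 + L) := by
    rw [hδ, div_le_iff₀ hX] at hδL
    linarith
  have hfin := final_ineq hq0 hqs.2 hy0 hy.2 hL
  have e1 := mul_le_mul_of_nonneg_left hYle hy0.le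
  have e2 := mul_le_mul_of_nonneg_left hfin hX.le
  nlinarith
end

section
/- Let α ∈ (0,1] and let D be an α-strongly regular value distribution with revenue curve R(q) = q·v(q) and monopoly quantile q*. Then for every q' ≠ q* with 0 ≤ q' ≤ 1, one has R(q*) − R(q') ≥ (α/3)·(q* − q')²·R(q*). -/
open MeasureTheory Set

/-- `α`-strong regularity: the virtual value satisfies `dφ/dv ≥ α` throughout the support. -/
def ValueDist.StronglyRegular (α : ℝ) (D : ValueDist) : Prop :=
  ∀ x ∈ D.supp, ∃ d : ℝ, α ≤ d ∧ HasDerivWithinAt D.phi d D.supp x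

namespace SRaux

lemma f_integrable (D : ValueDist) : Integrable D.f volume := by
  have h1 : ∫⁻ x, ENNReal.ofReal (D.f x) = 1 := by
    have := D.isProb.measure_univ
    rw [D.density_eq, withDensity_apply _ MeasurableSet.univ] at this
    simpa using this
  refine ⟨D.f_meas.aestronglyMeasurable, ?_⟩
  rw [hasFiniteIntegral_iff_ofReal (Filter.Eventually.of_forall D.f_nonneg), h1]
  simp

lemma F_eq (D : ValueDist) (x : ℝ) : D.F x = ∫ t in Iic x, D.f t := by
  unfold ValueDist.F
  rw [D.density_eq, withDensity_apply _ measurableSet_Iic,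
    integral_eq_lintegral_of_nonneg_ae (Filter.Eventually.of_forall D.f_nonneg)
      D.f_meas.aestronglyMeasurable]

lemma F_sub (D : ValueDist) (x y : ℝ) : D.F y = D.F x + ∫ t in x..y, D.f t := by
  rw [F_eq, F_eq, intervalIntegral.integral_Iic_sub_Iic (f_integrable D).integrableOn
    (f_integrable D).integrableOn |>.symm]
  ring

lemma F_mono (D : ValueDist) : Monotone D.F := by
  intro x y h
  rw [F_sub D x y]
  have := intervalIntegral.integral_nonneg_of_forall (μ := volume) h D.f_nonneg
  linarith

lemma F_cont (D : ValueDist) : Continuous D.F := by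
  have : D.F = fun y => D.F 0 + ∫ t in (0:ℝ)..y, D.f t := by
    funext y; exact F_sub D 0 y
  rw [this]
  exact continuous_const.add
    (intervalIntegral.continuous_primitive (fun a b => (f_integrable D).intervalIntegrable) 0)

lemma F_lt (D : ValueDist) {x y : ℝ} (hx : x ∈ D.supp) (hy : y ∈ D.supp) (h : x < y) :
    D.F x < D.F y := by
  rw [F_sub D x y]
  have := intervalIntegral.intervalIntegral_pos_of_pos_on
    ((f_integrable D).intervalIntegrable (a := x) (b := y))
    (fun t ht => D.f_pos t (D.supp_conn.out hx hy (Ioo_subset_Icc_self ht))) h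
  linarith

lemma supp_nhds (D : ValueDist) {x y t : ℝ} (hx : x ∈ D.supp) (hy : y ∈ D.supp)
    (ht : t ∈ Ioo x y) : D.supp ∈ nhds t :=
  Filter.mem_of_superset (Ioo_mem_nhds ht.1 ht.2)
    (fun _ hs => D.supp_conn.out hx hy (Ioo_subset_Icc_self hs))

lemma phi_growth (D : ValueDist) {α : ℝ} (hreg : D.StronglyRegular α) {x y : ℝ}
    (hx : x ∈ D.supp) (hy : y ∈ D.supp) (h : x ≤ y) :
    α * (y - x) ≤ D.phi y - D.phi x := by
  have hsub : Icc x y ⊆ D.supp := D.supp_conn.out hx hy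
  have key : MonotoneOn (fun t => D.phi t - α * t) (Icc x y) := by
    have hd : ∀ t ∈ Ioo x y, ∃ d, α ≤ d ∧ HasDerivAt (fun t => D.phi t - α * t) (d - α) t := by
      intro t ht
      obtain ⟨d, hd, h1⟩ := hreg t (hsub (Ioo_subset_Icc_self ht))
      refine ⟨d, hd, ?_⟩
      have h2 := h1.hasDerivAt (supp_nhds D hx hy ht)
      exact (h2.sub ((hasDerivAt_id t).const_mul α)).congr_deriv (by ring)
    apply monotoneOn_of_deriv_nonneg (convex_Icc x y)
    · intro t ht
      obtain ⟨d, hd, h1⟩ := hreg t (hsub ht)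
      exact (h1.continuousWithinAt.mono hsub).sub (by fun_prop)
    · rw [interior_Icc]
      intro t ht
      obtain ⟨d, _, h1⟩ := hd t ht
      exact h1.differentiableAt.differentiableWithinAt
    · rw [interior_Icc]
      intro t ht
      obtain ⟨d, h0, h1⟩ := hd t ht
      rw [h1.deriv]; linarith
  have := key (left_mem_Icc.2 h) (right_mem_Icc.2 h) h
  simp only at this
  linarith

lemma G_deriv (D : ValueDist) {α : ℝ} (hreg : D.StronglyRegular α) {x y t : ℝ}
    (hx : x ∈ D.supp) (hy : y ∈ D.supp) (ht : t ∈ Ioo x y) (hG : 0 < 1 - D.F t) :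
    HasDerivAt (fun s => 1 - D.F s) (-D.f t) t := by
  have hs := supp_nhds D hx hy ht
  have hts : t ∈ D.supp := mem_of_mem_nhds hs
  have hft := D.f_pos t hts
  have hne : t - D.phi t ≠ 0 := by
    have : t - D.phi t = (1 - D.F t) / D.f t := by unfold ValueDist.phi; ring
    rw [this]; positivity
  have hphi : ContinuousAt D.phi t := by
    obtain ⟨d, hd, h1⟩ := hreg t hts
    exact (h1.hasDerivAt hs).continuousAt
  have hFc : ContinuousAt D.F t := (F_cont D).continuousAt
  have hc : ContinuousAt (fun s => (1 - D.F s) / (s - D.phi s)) t := by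
    apply ContinuousAt.div
    · fun_prop
    · fun_prop
    · exact hne
  have hpos : ∀ᶠ s in nhds t, 0 < 1 - D.F s :=
    (continuousAt_const.sub hFc).eventually_const_lt hG
  have hfc : ContinuousAt D.f t := by
    apply hc.congr
    filter_upwards [hs, hpos] with s h1 h2
    have h3 := D.f_pos s h1
    have : s - D.phi s = (1 - D.F s) / D.f s := by unfold ValueDist.phi; ring
    rw [this]; field_simp
  have h1 := intervalIntegral.integral_hasDerivAt_right
    ((f_integrable D).intervalIntegrable (a := 0) (b := t))
    (D.f_meas.stronglyMeasurable.stronglyMeasurableAtFilter) hfc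
  have h2 : (fun s => 1 - D.F s) = fun s => (1 - D.F 0) - ∫ u in (0:ℝ)..s, D.f u := by
    funext s; rw [F_sub D 0 s]; ring
  rw [h2]
  simpa using h1.const_sub (1 - D.F 0)

lemma rev_deriv (D : ValueDist) {α : ℝ} (hreg : D.StronglyRegular α) {x y t : ℝ}
    (hx : x ∈ D.supp) (hy : y ∈ D.supp) (ht : t ∈ Ioo x y) (hG : 0 < 1 - D.F t) :
    HasDerivAt (fun s => s * (1 - D.F s)) (-(D.f t * D.phi t)) t := by
  have h := (hasDerivAt_id t).mul (G_deriv D hreg hx hy ht hG)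
  have hft := D.f_pos t (mem_of_mem_nhds (supp_nhds D hx hy ht))
  refine h.congr_deriv ?_
  unfold ValueDist.phi
  simp only [id]
  field_simp
  ring

/-- MVT: between `a<b` there is `c` with `-(f φ)(c) (b-a) = R b - R a`. -/
lemma rev_mvt (D : ValueDist) {α : ℝ} (hreg : D.StronglyRegular α) {a b : ℝ}
    (ha : a ∈ D.supp) (hb : b ∈ D.supp) (hab : a < b) (hG : 0 < 1 - D.F b) :
    ∃ c ∈ Ioo a b, -(D.f c * D.phi c) * (b - a) = b * (1 - D.F b) - a * (1 - D.F a) := by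
  have hFc := F_cont D
  obtain ⟨c, hc, h⟩ := exists_hasDerivAt_eq_slope (fun s => s * (1 - D.F s))
    (fun t => -(D.f t * D.phi t)) hab (by fun_prop)
    (fun t ht => rev_deriv D hreg ha hb ht (by
      have := F_mono D ht.2.le; linarith))
  refine ⟨c, hc, ?_⟩
  rw [h]
  have : b - a ≠ 0 := by linarith
  field_simp

noncomputable def H (D : ValueDist) (α s Rs x : ℝ) : ℝ :=
  (1 - D.F x) ^ (-α) * (x * (1 - D.F x) - (Rs - α/3 * Rs * ((1 - D.F x) - s)^2))

lemma H_deriv (D : ValueDist) {α : ℝ} (s Rs : ℝ) (hreg : D.StronglyRegular α) {x y t : ℝ}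
    (hx : x ∈ D.supp) (hy : y ∈ D.supp) (ht : t ∈ Ioo x y) (hG : 0 < 1 - D.F t) :
    HasDerivAt (H D α s Rs) (D.f t * (1 - D.F t)^(-α) * (-D.phi t + α * t
      - α * (Rs - α/3 * Rs * ((1 - D.F t) - s)^2) / (1 - D.F t)
      - 2 * α / 3 * Rs * ((1 - D.F t) - s))) t := by
  have hg := G_deriv D hreg hx hy ht hG
  have h1 := hg.rpow_const (p := -α) (Or.inl hG.ne')
  have h2 := (rev_deriv D hreg hx hy ht hG).sub
    ((((hg.sub_const s).pow 2).const_mul (α/3 * Rs)).const_sub Rs)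
  have h3 := h1.mul h2
  refine h3.congr_deriv ?_
  simp only [Pi.sub_apply, Pi.pow_apply]
  rw [Real.rpow_sub_one hG.ne']
  field_simp
  ring

lemma H_cont (D : ValueDist) (α s Rs : ℝ) {a b : ℝ} (hG : 0 < 1 - D.F b) :
    ContinuousOn (H D α s Rs) (Icc a b) := by
  have hFc := F_cont D
  unfold H
  apply ContinuousOn.mul
  · apply ContinuousOn.rpow_const (by fun_prop)
    intro x hx
    left
    have := F_mono D hx.2
    linarith
  · fun_prop

lemma bracket (α s Rs g : ℝ) (hα : 0 < α) (hα1 : α ≤ 1) (hs : 0 < s) (hs1 : s ≤ 1)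
    (hg : 0 < g) (hg1 : g ≤ 1) (hR : 0 ≤ Rs) :
    ∃ k : ℝ, 0 ≤ k ∧ α * (Rs / s) - α * (Rs - α/3 * Rs * (g - s)^2) / g
      - 2 * α / 3 * Rs * (g - s) = k * (g - s) := by
  refine ⟨α * Rs / g * (1/s - α/3 * (s - g) - 2/3 * g), ?_, ?_⟩
  · apply mul_nonneg (by positivity)
    have : 1 ≤ 1/s := by rw [le_div_iff₀ hs]; linarith
    nlinarith [mul_pos hα hg, mul_pos hα hs]
  · field_simp
    ring

end SRaux

open SRaux in
theorem strongly_regular_quadratic_revenue_loss (α : ℝ) (hα : α ∈ Ioc (0:ℝ) 1)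
    (D : ValueDist) (hreg : D.StronglyRegular α)
    (v : ℝ → ℝ)
    (hv : ∀ q ∈ Ioc (0:ℝ) 1, v q ∈ D.supp ∧ 1 - D.F (v q) = q)
    (qs : ℝ) (hqs : qs ∈ Icc (0:ℝ) 1)
    (hmax : ∀ q ∈ Icc (0:ℝ) 1, q * v q ≤ qs * v qs) :
    ∀ q' ∈ Icc (0:ℝ) 1, q' ≠ qs →
      qs * v qs - q' * v q' ≥ α/3 * (qs - q')^2 * (qs * v qs) := by
  intro q' hq' hne
  obtain ⟨hα0, hα1⟩ := hα
  rcases hqs.1.eq_or_lt with h0 | hs0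
  · have := hmax q' hq'
    rw [← h0] at this ⊢
    simp only [zero_mul, mul_zero] at this ⊢
    linarith
  obtain ⟨hxs, hGs⟩ := hv qs ⟨hs0, hqs.2⟩
  have hxs0 : 0 ≤ v qs := D.supp_subset hxs
  have hR : 0 ≤ qs * v qs := by positivity
  rcases hq'.1.eq_or_lt with h0 | hq0
  · rw [← h0]
    have : α / 3 * (qs - 0)^2 ≤ 1 := by nlinarith [hqs.2]
    nlinarith
  obtain ⟨hx', hG'⟩ := hv q' ⟨hq0, hq'.2⟩
  have hF0 : ∀ x, 0 ≤ D.F x := fun x => ENNReal.toReal_nonneg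
  have hmax' : ∀ x ∈ D.supp, 0 < 1 - D.F x → x * (1 - D.F x) ≤ qs * v qs := by
    intro x hx hG
    have hle : 1 - D.F x ≤ 1 := by linarith [hF0 x]
    obtain ⟨h1, h2⟩ := hv (1 - D.F x) ⟨hG, hle⟩
    have h3 : v (1 - D.F x) = x := by
      rcases lt_trichotomy (v (1 - D.F x)) x with h | h | h
      · have := F_lt D h1 hx h; linarith
      · exact h
      · have := F_lt D hx h1 h; linarith
    have h4 := hmax _ ⟨hG.le, hle⟩
    rw [h3] at h4
    linarith
  have hRs : (qs * v qs) / qs = v qs := by field_simp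
  have hHs : H D α qs (qs * v qs) (v qs) = 0 := by
    unfold H; rw [hGs]; ring
  suffices hH : H D α qs (qs * v qs) (v q') ≤ 0 by
    unfold H at hH
    rw [hG'] at hH
    have := nonpos_of_mul_nonpos_right hH (Real.rpow_pos_of_pos hq0 _)
    nlinarith
  rcases lt_or_gt_of_ne hne with hlt | hgt
  · -- q' < qs
    have hxlt : v qs < v q' := by
      by_contra hcon
      have := F_mono D (not_lt.1 hcon)
      linarith
    have hsub : Icc (v qs) (v q') ⊆ D.supp := D.supp_conn.out hxs hx'
    have hGpos : ∀ t ≤ v q', 0 < 1 - D.F t := fun t ht => by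
      have := F_mono D ht; linarith
    have hphi : ∀ t ∈ Ioo (v qs) (v q'), α * (t - v qs) ≤ D.phi t := by
      intro t ht
      apply le_of_forall_pos_le_add
      intro ε hε
      set b := min t (v qs + ε) with hb
      have hb1 : v qs < b := lt_min ht.1 (by linarith)
      have hbt : b ≤ t := min_le_left _ _
      have hbe : b ≤ v qs + ε := min_le_right _ _
      have hbs : b ∈ D.supp := hsub ⟨hb1.le, hbt.trans ht.2.le⟩
      have hGb := hGpos b (hbt.trans ht.2.le)
      obtain ⟨c, hc, h⟩ := rev_mvt D hreg hxs hbs hb1 hGb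
      have h1 := hmax' b hbs hGb
      rw [hGs] at h
      have hcs : c ∈ D.supp := hsub ⟨hc.1.le, by linarith [hc.2, ht.2]⟩
      have hfc := D.f_pos c hcs
      have hphic : 0 ≤ D.phi c := by
        by_contra hcon
        have : 0 < D.f c * (-D.phi c) * (b - v qs) :=
          mul_pos (mul_pos hfc (by linarith)) (by linarith)
        nlinarith
      have h2 := phi_growth D hreg hcs (hsub (Ioo_subset_Icc_self ht)) (by linarith [hc.2])
      nlinarith [hc.2]
    have hanti : AntitoneOn (H D α qs (qs * v qs)) (Icc (v qs) (v q')) := by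
      apply antitoneOn_of_deriv_nonpos (convex_Icc _ _) (H_cont D _ _ _ (hGpos _ le_rfl))
      · rw [interior_Icc]
        intro t ht
        exact (H_deriv D qs (qs * v qs) hreg hxs hx' ht
          (hGpos t ht.2.le)).differentiableAt.differentiableWithinAt
      · rw [interior_Icc]
        intro t ht
        have hg := hGpos t ht.2.le
        rw [(H_deriv D qs (qs * v qs) hreg hxs hx' ht hg).deriv]
        have hft := D.f_pos t (hsub (Ioo_subset_Icc_self ht))
        apply mul_nonpos_of_nonneg_of_nonpos
        · exact mul_nonneg hft.le (Real.rpow_nonneg hg.le _)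
        · obtain ⟨k, hk, he⟩ := bracket α qs (qs * v qs) (1 - D.F t) hα0 hα1 hs0 hqs.2 hg
            (by linarith [hF0 t]) hR
          rw [hRs] at he
          have h1 := hphi t ht
          have h2 := F_mono D ht.1.le
          have h3 : k * (1 - D.F t - qs) ≤ 0 :=
            mul_nonpos_of_nonneg_of_nonpos hk (by linarith)
          linarith
    have := hanti (left_mem_Icc.2 hxlt.le) (right_mem_Icc.2 hxlt.le) hxlt.le
    linarith
  · have hxlt : v q' < v qs := by
      by_contra hcon
      have := F_mono D (not_lt.1 hcon)
      linarith
    have hsub : Icc (v q') (v qs) ⊆ D.supp := D.supp_conn.out hx' hxs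
    have hGpos : ∀ t ≤ v qs, 0 < 1 - D.F t := fun t ht => by
      have := F_mono D ht; linarith
    have hphi : ∀ t ∈ Ioo (v q') (v qs), D.phi t ≤ α * (t - v qs) := by
      intro t ht
      apply le_of_forall_pos_le_add
      intro ε hε
      set b := max t (v qs - ε) with hb
      have hb1 : b < v qs := max_lt ht.2 (by linarith)
      have hbt : t ≤ b := le_max_left _ _
      have hbe : v qs - ε ≤ b := le_max_right _ _
      have hbs : b ∈ D.supp := hsub ⟨ht.1.le.trans hbt, hb1.le⟩
      have hGb := hGpos b hb1.le
      obtain ⟨c, hc, h⟩ := rev_mvt D hreg hbs hxs hb1 (hGpos _ le_rfl)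
      have h1 := hmax' b hbs hGb
      rw [hGs] at h
      have hcs : c ∈ D.supp := hsub ⟨by linarith [hc.1, ht.1], hc.2.le⟩
      have hfc := D.f_pos c hcs
      have hphic : D.phi c ≤ 0 := by
        by_contra hcon
        have : 0 < D.f c * (D.phi c) * (v qs - b) :=
          mul_pos (mul_pos hfc (by linarith)) (by linarith)
        nlinarith
      have h2 := phi_growth D hreg (hsub (Ioo_subset_Icc_self ht)) hcs (by linarith [hc.1])
      nlinarith [hc.1]
    have hmono : MonotoneOn (H D α qs (qs * v qs)) (Icc (v q') (v qs)) := by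
      apply monotoneOn_of_deriv_nonneg (convex_Icc _ _) (H_cont D _ _ _ (hGpos _ le_rfl))
      · rw [interior_Icc]
        intro t ht
        exact (H_deriv D qs (qs * v qs) hreg hx' hxs ht
          (hGpos t ht.2.le)).differentiableAt.differentiableWithinAt
      · rw [interior_Icc]
        intro t ht
        have hg := hGpos t ht.2.le
        rw [(H_deriv D qs (qs * v qs) hreg hx' hxs ht hg).deriv]
        have hft := D.f_pos t (hsub (Ioo_subset_Icc_self ht))
        apply mul_nonneg
        · exact mul_nonneg hft.le (Real.rpow_nonneg hg.le _)
        · obtain ⟨k, hk, he⟩ := bracket α qs (qs * v qs) (1 - D.F t) hα0 hα1 hs0 hqs.2 hg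
            (by linarith [hF0 t]) hR
          rw [hRs] at he
          have h1 := hphi t ht
          have h2 := F_mono D ht.2.le
          have h3 : 0 ≤ k * (1 - D.F t - qs) := mul_nonneg hk (by linarith)
          linarith
    have := hmono (left_mem_Icc.2 hxlt.le) (right_mem_Icc.2 hxlt.le) hxlt.le
    linarith
end

section
/- Fix a constant α ∈ (0,1). There is a constant C_α > 0 (depending only on α) such that for every ε ∈ (0,1), every α-strongly regular value distribution D, and every integer m ≥ C_α·ε^{−3/2}·log(1/ε), the empirical reserve price computed from m i.i.d. samples from D (guarded at α^{1/(1−α)}) has expected revenue at least (1−ε)·R*, where R* = max_p p·(1−F(p)) is the optimal revenue of D. -/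
open MeasureTheory Set

/-- Number of samples with value at least `t` (the empirical sale count of price `t`). -/
noncomputable def empCount {m : ℕ} (s : Fin m → ℝ) (t : ℝ) : ℕ := {j | t ≤ s j}.ncard

/-- `r` is a `c`-guarded empirical reserve for the samples `s`. -/
def IsGuardedEmpiricalReserve {m : ℕ} (c : ℝ) (s : Fin m → ℝ) (r : ℝ) : Prop :=
  (∃ i, r = s i) ∧ c * m ≤ (empCount s r : ℝ) ∧
    ∀ i : Fin m, c * m ≤ (empCount s (s i) : ℝ) →
      s i * (empCount s (s i) : ℝ) ≤ r * (empCount s r : ℝ)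

/-- Survival function. -/
noncomputable def ValueDist.q (D : ValueDist) (x : ℝ) : ℝ := 1 - D.F x

lemma ValueDist.f_lint (D : ValueDist) : ∫⁻ x, ENNReal.ofReal (D.f x) = 1 := by
  have := D.isProb.measure_univ
  rw [D.density_eq] at this
  simpa using this

lemma ValueDist.f_int (D : ValueDist) : Integrable D.f := by
  refine ⟨D.f_meas.aestronglyMeasurable, ?_⟩
  rw [hasFiniteIntegral_iff_ofReal (Filter.Eventually.of_forall D.f_nonneg), D.f_lint]
  simp

lemma ValueDist.noAtoms (D : ValueDist) : NullSingletonClass D.μ := by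
  rw [D.density_eq]; infer_instance

lemma ValueDist.F_eq_s3 (D : ValueDist) (v : ℝ) : D.F v = ∫ x in Iic v, D.f x := by
  rw [ValueDist.F, D.density_eq, withDensity_apply _ measurableSet_Iic,
    integral_eq_lintegral_of_nonneg_ae (Filter.Eventually.of_forall D.f_nonneg)
      D.f_meas.aestronglyMeasurable]

lemma ValueDist.F_eq' (D : ValueDist) (v : ℝ) : D.F v = D.F 0 + ∫ x in (0:ℝ)..v, D.f x := by
  rw [D.F_eq_s3, D.F_eq_s3, ← intervalIntegral.integral_Iic_sub_Iic
    D.f_int.integrableOn D.f_int.integrableOn]; ring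

lemma ValueDist.q_cont (D : ValueDist) : Continuous D.q := by
  have : D.q = fun v => 1 - (D.F 0 + ∫ x in (0:ℝ)..v, D.f x) := by
    ext v; rw [ValueDist.q, D.F_eq']
  rw [this]
  have := intervalIntegral.continuous_primitive
    (fun a b => D.f_int.intervalIntegrable (a := a) (b := b)) 0
  fun_prop

lemma ValueDist.q_eq (D : ValueDist) (v : ℝ) : D.q v = D.μ.real (Ioi v) := by
  have := D.isProb
  rw [ValueDist.q, ValueDist.F, ← compl_Iic, probReal_compl_eq_one_sub measurableSet_Iic]; rfl

lemma ValueDist.q_eq' (D : ValueDist) (v : ℝ) : D.q v = D.μ.real (Ici v) := by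
  have := D.noAtoms
  rw [D.q_eq]
  exact measureReal_congr Ioi_ae_eq_Ici

lemma ValueDist.q_nonneg (D : ValueDist) (v : ℝ) : 0 ≤ D.q v := by
  rw [D.q_eq]; positivity

lemma ValueDist.q_le (D : ValueDist) (v : ℝ) : D.q v ≤ 1 := by
  have := D.isProb
  rw [D.q_eq]; exact measureReal_le_one

lemma ValueDist.q_anti (D : ValueDist) : Antitone D.q := by
  have := D.isProb
  intro a b h
  rw [D.q_eq, D.q_eq]; exact measureReal_mono (Ioi_subset_Ioi h)

lemma ValueDist.I_full (D : ValueDist) : D.μ (interior D.supp)ᶜ = 0 := by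
  have h1 : volume (frontier D.supp) = 0 := D.supp_conn.convex.addHaar_frontier volume
  have h2 : D.μ (D.supp)ᶜ = 0 := by
    have hs : MeasurableSet D.supp := D.supp_conn.measurableSet
    rw [D.density_eq, withDensity_apply _ hs.compl,
      setLIntegral_congr_fun hs.compl (g := fun _ => 0)]
    · simp
    · intro x hx; simp [D.f_zero x hx]
  have h3 : D.μ (frontier D.supp) = 0 := by
    rw [D.density_eq]; exact withDensity_absolutelyContinuous _ _ h1
  refine measure_mono_null (t := D.suppᶜ ∪ frontier D.supp) ?_ (measure_union_null h2 h3)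
  intro x hx
  by_cases h : x ∈ D.supp
  · right; exact ⟨subset_closure h, hx⟩
  · left; exact h

lemma ValueDist.I_conn (D : ValueDist) : (interior D.supp).OrdConnected := D.supp_conn.interior

lemma ValueDist.I_nonempty (D : ValueDist) : (interior D.supp).Nonempty := by
  have := D.isProb
  by_contra h
  rw [not_nonempty_iff_eq_empty] at h
  have := D.I_full
  rw [h] at this
  simp at this

lemma ValueDist.q_zero_of (D : ValueDist) (v : ℝ) (h : ∀ u ∈ interior D.supp, u ≤ v) : D.q v = 0 := by
  have : D.μ (Ioi v) = 0 := by
    refine measure_mono_null ?_ D.I_full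
    intro x hx hI
    exact absurd (h x hI) (not_le.2 hx)
  rw [D.q_eq, measureReal_def, this]; rfl

lemma ValueDist.q_one_of (D : ValueDist) (v : ℝ) (h : ∀ u ∈ interior D.supp, v ≤ u) : D.q v = 1 := by
  have h0 : D.μ (Iio v) = 0 := by
    refine measure_mono_null ?_ D.I_full
    intro x hx hI
    exact absurd (h x hI) (not_le.2 hx)
  have := D.isProb
  rw [D.q_eq', ← compl_Iio, probReal_compl_eq_one_sub measurableSet_Iio, measureReal_def, h0]; simp

lemma ValueDist.tri (D : ValueDist) (v : ℝ) (h : v ∉ interior D.supp) :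
    (∀ u ∈ interior D.supp, u ≤ v) ∨ (∀ u ∈ interior D.supp, v ≤ u) := by
  by_contra! hh
  obtain ⟨⟨a, ha, hav⟩, ⟨b, hb, hbv⟩⟩ := hh
  exact h (D.I_conn.out hb ha ⟨hbv.le, hav.le⟩)

lemma ValueDist.q_pos (D : ValueDist) (v : ℝ) (h : v ∈ interior D.supp) : 0 < D.q v := by
  rcases (D.q_nonneg v).lt_or_eq with h1 | h1
  · exact h1
  exfalso
  have := D.isProb
  have h2 : D.μ (Ioi v) = 0 := by
    rw [D.q_eq, measureReal_def] at h1
    simpa [ENNReal.toReal_eq_zero_iff] using h1.symm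
  rw [D.density_eq, withDensity_apply _ measurableSet_Ioi, setLIntegral_eq_zero_iff measurableSet_Ioi
    (by have := D.f_meas; fun_prop)] at h2
  obtain ⟨e, he, hI⟩ := Metric.isOpen_iff.1 isOpen_interior v h
  have h3 : volume (Ioo v (v+e)) = 0 := by
    refine measure_mono_null ?_ (ae_iff.1 h2)
    intro x hx
    have hxI : x ∈ D.supp := interior_subset (hI (by
      rw [Metric.mem_ball, Real.dist_eq, abs_lt]; constructor <;> linarith [hx.1, hx.2]))
    have := D.f_pos x hxI
    simp [hx.1, this]
  simp [he.not_ge] at h3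

lemma ValueDist.phi_deriv (D : ValueDist) {α : ℝ} (hD : D.StronglyRegular α) (v : ℝ)
    (h : v ∈ interior D.supp) : ∃ d, α ≤ d ∧ HasDerivAt D.phi d v := by
  obtain ⟨d, h1, h2⟩ := hD v (interior_subset h)
  exact ⟨d, h1, h2.hasDerivAt (mem_interior_iff_mem_nhds.1 h)⟩

/-- inverse hazard rate. -/
noncomputable def ValueDist.h (D : ValueDist) (x : ℝ) : ℝ := D.q x / D.f x

lemma ValueDist.h_pos (D : ValueDist) (v : ℝ) (h : v ∈ interior D.supp) : 0 < D.h v :=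
  div_pos (D.q_pos v h) (D.f_pos v (interior_subset h))

lemma ValueDist.h_deriv (D : ValueDist) {α : ℝ} (hD : D.StronglyRegular α) (v : ℝ)
    (h : v ∈ interior D.supp) : ∃ d, d ≤ 1 - α ∧ HasDerivAt D.h d v := by
  obtain ⟨d, h1, h2⟩ := D.phi_deriv hD v h
  refine ⟨1 - d, by linarith, ?_⟩
  have : D.h = fun x => x - D.phi x := by
    ext x; simp [ValueDist.h, ValueDist.phi, ValueDist.q]
  rw [this]
  exact (hasDerivAt_id v).sub h2

lemma ValueDist.q_deriv (D : ValueDist) {α : ℝ} (hD : D.StronglyRegular α) (v : ℝ)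
    (h : v ∈ interior D.supp) : HasDerivAt D.q (-(D.q v / D.h v)) v := by
  have hf : ∀ x ∈ interior D.supp, D.f x = D.q x / D.h x := by
    intro x hx
    have h1 := D.q_pos x hx
    have h2 := D.f_pos x (interior_subset hx)
    rw [ValueDist.h]; field_simp
  have hc : ContinuousAt D.f v := by
    obtain ⟨d, -, h2⟩ := D.h_deriv hD v h
    have : ContinuousAt (fun x => D.q x / D.h x) v :=
      D.q_cont.continuousAt.div h2.continuousAt (D.h_pos v h).ne'
    refine this.congr ?_
    filter_upwards [isOpen_interior.mem_nhds h] with x hx using (hf x hx).symm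
  have e : D.q = fun v => 1 - (D.F 0 + ∫ x in (0:ℝ)..v, D.f x) := by
    ext v; rw [ValueDist.q, D.F_eq']
  rw [← hf v h]
  have := intervalIntegral.integral_hasDerivAt_right (D.f_int.intervalIntegrable (a := 0) (b := v))
    D.f_meas.stronglyMeasurable.stronglyMeasurableAtFilter hc
  rw [e]
  exact (this.const_add _).const_sub _

lemma ValueDist.tangent_I (D : ValueDist) {α : ℝ} (hα1 : α < 1) (hD : D.StronglyRegular α)
    {v₀ v : ℝ} (h₀ : v₀ ∈ interior D.supp) (hv : v ∈ interior D.supp) :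
    (D.q v) ^ (1-α) * (1 + (1-α) * (v - v₀) / D.h v₀) ≤ (D.q v₀) ^ (1-α) := by
  set β := 1 - α with hβ
  set I := interior D.supp with hI
  have hIo : IsOpen I := isOpen_interior
  have hIc : I.OrdConnected := D.I_conn
  set k : ℝ → ℝ := fun x => (D.q x) ^ (-β) / D.h x with hk
  have hkd : ∀ x ∈ I, ∃ d, 0 ≤ d ∧ HasDerivAt k d x := by
    intro x hx
    obtain ⟨d, hd, hd'⟩ := D.h_deriv hD x hx
    have hq := D.q_pos x hx
    have hh := D.h_pos x hx
    have h1 := (D.q_deriv hD x hx).rpow_const (p := -β) (Or.inl hq.ne')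
    have h2 := h1.div hd' hh.ne'
    refine ⟨_, ?_, h2⟩
    have e : D.q x ^ (-β - 1) = D.q x ^ (-β) / D.q x := by
      rw [Real.rpow_sub_one hq.ne']
    rw [e]
    have hp : 0 < D.q x ^ (-β) := Real.rpow_pos_of_pos hq _
    have : (-(D.q x / D.h x) * -β * (D.q x ^ (-β) / D.q x) * D.h x - D.q x ^ (-β) * d) / D.h x ^ 2
        = D.q x ^ (-β) * (β - d) / D.h x ^ 2 := by
      field_simp
    rw [this]
    have : 0 ≤ β - d := by linarith
    positivity
  have hkm : MonotoneOn k I := by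
    apply monotoneOn_of_deriv_nonneg hIc.convex
    · intro x hx; obtain ⟨d, -, h⟩ := hkd x hx; exact h.continuousAt.continuousWithinAt
    · intro x hx; obtain ⟨d, -, h⟩ := hkd x (interior_subset hx)
      exact h.differentiableAt.differentiableWithinAt
    · intro x hx; obtain ⟨d, h0, h⟩ := hkd x (interior_subset hx)
      rw [h.deriv]; exact h0
  set w : ℝ → ℝ := fun x => (D.q x) ^ (-β) with hw
  have hwd : ∀ x ∈ I, HasDerivAt w (β * k x) x := by
    intro x hx
    have hq := D.q_pos x hx
    have hh := D.h_pos x hx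
    have h1 := (D.q_deriv hD x hx).rpow_const (p := -β) (Or.inl hq.ne')
    convert h1 using 1
    rw [Real.rpow_sub_one hq.ne']
    simp only [hk]
    field_simp
  have hβ0 : 0 ≤ β := by linarith
  have key : w v₀ + β * k v₀ * (v - v₀) ≤ w v := by
    rcases lt_trichotomy v v₀ with h | h | h
    · have hs : Icc v v₀ ⊆ I := hIc.out hv h₀
      obtain ⟨c, hc, hc'⟩ := exists_hasDerivAt_eq_slope w (fun x => β * k x) h
        (fun x hx => (hwd x (hs hx)).continuousAt.continuousWithinAt)
        (fun x hx => hwd x (hs (Ioo_subset_Icc_self hx)))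
      rw [eq_div_iff (by linarith)] at hc'
      have := hkm (hs (Ioo_subset_Icc_self hc)) h₀ hc.2.le
      have : β * k c ≤ β * k v₀ := mul_le_mul_of_nonneg_left this hβ0
      nlinarith
    · simp [h]
    · have hs : Icc v₀ v ⊆ I := hIc.out h₀ hv
      obtain ⟨c, hc, hc'⟩ := exists_hasDerivAt_eq_slope w (fun x => β * k x) h
        (fun x hx => (hwd x (hs hx)).continuousAt.continuousWithinAt)
        (fun x hx => hwd x (hs (Ioo_subset_Icc_self hx)))
      rw [eq_div_iff (by linarith)] at hc'
      have := hkm h₀ (hs (Ioo_subset_Icc_self hc)) hc.1.le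
      have : β * k v₀ ≤ β * k c := mul_le_mul_of_nonneg_left this hβ0
      nlinarith
  have q0 := D.q_pos v₀ h₀
  have q1 := D.q_pos v hv
  have hh := D.h_pos v₀ h₀
  simp only [hw, hk] at key
  rw [Real.rpow_neg q0.le, Real.rpow_neg q1.le] at key
  have p0 : 0 < D.q v₀ ^ β := Real.rpow_pos_of_pos q0 _
  have p1 : 0 < D.q v ^ β := Real.rpow_pos_of_pos q1 _
  have e : (D.q v₀ ^ β)⁻¹ + β * ((D.q v₀ ^ β)⁻¹ / D.h v₀) * (v - v₀) =
    (1 + β * (v - v₀) / D.h v₀) / D.q v₀ ^ β := by field_simp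
  rw [e, div_le_iff₀ p0, inv_mul_eq_div, le_div_iff₀ p1] at key
  linarith

lemma ValueDist.tangent (D : ValueDist) {α : ℝ} (hα : α < 1) (hD : D.StronglyRegular α)
    {v₀ : ℝ} (h₀ : v₀ ∈ interior D.supp) (v : ℝ) :
    (D.q v) ^ (1-α) * (1 + (1-α) * (v - v₀) / D.h v₀) ≤ (D.q v₀) ^ (1-α) := by
  by_cases hv : v ∈ interior D.supp
  · exact D.tangent_I hα hD h₀ hv
  have hβ : 0 < 1 - α := by linarith
  have hh := D.h_pos v₀ h₀
  rcases D.tri v hv with h | h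
  · rw [D.q_zero_of v h, Real.zero_rpow hβ.ne']
    simpa using Real.rpow_nonneg (D.q_nonneg v₀) _
  have hne := D.I_nonempty
  have hbd : BddBelow (interior D.supp) := ⟨v, h⟩
  have ha := csInf_mem_closure hne hbd
  set a := sInf (interior D.supp)
  have hva : v ≤ a := le_csInf hne h
  have hqa : D.q a = 1 := D.q_one_of a fun u hu => csInf_le hbd hu
  have hqc := D.q_cont
  have hcl : IsClosed {u : ℝ | (D.q u) ^ (1-α) * (1 + (1-α) * (u - v₀) / D.h v₀) ≤ (D.q v₀) ^ (1-α)} := by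
    apply isClosed_le _ continuous_const
    have : Continuous fun u => D.q u ^ (1-α) := hqc.rpow_const (fun _ => Or.inr hβ.le)
    fun_prop
  have h1 : a ∈ {u : ℝ | (D.q u) ^ (1-α) * (1 + (1-α) * (u - v₀) / D.h v₀) ≤ (D.q v₀) ^ (1-α)} :=
    closure_minimal (fun u hu => D.tangent_I hα hD h₀ hu) hcl ha
  simp only [mem_ofPred_eq, hqa] at h1
  rw [D.q_one_of v h]
  refine le_trans ?_ h1
  gcongr

lemma rpow_bern {β x : ℝ} (hβ0 : 0 ≤ β) (hβ1 : β ≤ 1) (hx : 0 ≤ x) : x ^ β ≤ 1 + β * (x - 1) := by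
  have := rpow_one_add_le_one_add_mul_self (s := x - 1) (by linarith) hβ0 hβ1
  simpa using this

/-- Weak form: tangent line bound of the revenue curve. -/
lemma weak_tangent {β a b t : ℝ} (hβ0 : 0 < β) (hβ1 : β ≤ 1) (ha : 0 ≤ a) (hb : 0 ≤ b)
    (ht : -1 ≤ t) (h : a ^ β * (1 + β * t) ≤ b ^ β) : a * (1 + t) ≤ b := by
  have h1 := rpow_bern hβ0.le hβ1 (x := 1 + t) (by linarith)
  have h2 : (a * (1 + t)) ^ β ≤ b ^ β := by
    rw [Real.mul_rpow ha (by linarith)]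
    refine le_trans ?_ h
    apply mul_le_mul_of_nonneg_left _ (Real.rpow_nonneg ha _)
    linarith
  exact (Real.rpow_le_rpow_iff (mul_nonneg ha (by linarith)) hb hβ0).1 h2

lemma ValueDist.exists_max (D : ValueDist) {α : ℝ} (hα : 0 < α) (hα1 : α < 1) (hD : D.StronglyRegular α) :
    ∃ v, 0 < v ∧ 0 < D.q v ∧ ∀ u, u * D.q u ≤ v * D.q v := by
  obtain ⟨v₀, h₀⟩ := D.I_nonempty
  have hβ : 0 < 1 - α := by linarith
  have hh := D.h_pos v₀ h₀
  have hp0 : 0 < v₀ := by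
    obtain ⟨e, he, hI⟩ := Metric.isOpen_iff.1 isOpen_interior v₀ h₀
    have : v₀ - e / 2 ∈ D.supp := interior_subset (hI (by
      rw [Metric.mem_ball, Real.dist_eq, abs_lt]; constructor <;> linarith))
    have := D.supp_subset this
    simp only [mem_Ici] at this
    linarith
  have hq0 := D.q_pos v₀ h₀
  have hR0 : 0 < v₀ * D.q v₀ := by positivity
  set B := (1 - α) / D.h v₀ / 2 with hB
  have hBp : 0 < B := by positivity
  have hlim : Filter.Tendsto (fun v : ℝ => v ^ (-α)) Filter.atTop (nhds 0) := tendsto_rpow_neg_atTop hα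
  have hev := hlim.eventually (gt_mem_nhds (show 0 < B * (v₀ * D.q v₀) ^ (1-α) by positivity))
  obtain ⟨V, hV⟩ := Filter.eventually_atTop.1 hev
  set M := max V (2 * v₀) with hM
  have hMv : v₀ ≤ M := le_trans (by linarith) (le_max_right V (2*v₀))
  have hlarge : ∀ u, M ≤ u → u * D.q u ≤ v₀ * D.q v₀ := by
    intro u hu
    have hu1 : V ≤ u := le_trans (le_max_left _ _) hu
    have hu2 : 2 * v₀ ≤ u := le_trans (le_max_right _ _) hu
    have hup : 0 < u := by linarith
    have h1 := D.tangent hα1 hD h₀ u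
    have h2 : D.q v₀ ^ (1-α) ≤ 1 := Real.rpow_le_one hq0.le (D.q_le _) hβ.le
    have h3 : B * u ≤ 1 + (1-α) * (u - v₀) / D.h v₀ := by
      rw [hB]
      have : (1-α) * (u - v₀) / D.h v₀ = (1 - α) / D.h v₀ / 2 * (2 * (u - v₀)) := by field_simp
      rw [this, ← hB]
      nlinarith
    have hqn := Real.rpow_nonneg (D.q_nonneg u) (1-α)
    have h4 : D.q u ^ (1-α) * (B * u) ≤ 1 := by
      refine le_trans (mul_le_mul_of_nonneg_left h3 hqn) (h1.trans h2)
    have h5 : (u * D.q u) ^ (1-α) ≤ (v₀ * D.q v₀) ^ (1-α) := by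
      rw [Real.mul_rpow hup.le (D.q_nonneg u)]
      have e : u ^ (1-α) = u * u ^ (-α) := by
        rw [sub_eq_add_neg, Real.rpow_add hup, Real.rpow_one]
      have h6 := hV u hu1
      have h7 : 0 ≤ u ^ (-α) := Real.rpow_nonneg hup.le _
      have h8 : B * (u ^ (1-α) * D.q u ^ (1-α)) ≤ u ^ (-α) := by
        rw [e]
        calc _ = u ^ (-α) * (D.q u ^ (1-α) * (B * u)) := by ring
          _ ≤ u ^ (-α) * 1 := mul_le_mul_of_nonneg_left h4 h7
          _ = _ := mul_one _
      have := h8.trans h6.le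
      exact le_of_mul_le_mul_left this hBp
    exact (Real.rpow_le_rpow_iff (mul_nonneg hup.le (D.q_nonneg u)) hR0.le hβ).1 h5
  have hqc := D.q_cont
  obtain ⟨v, hv, hmax⟩ := (isCompact_Icc (a := (0:ℝ)) (b := M)).exists_isMaxOn ⟨v₀, hp0.le, hMv⟩
    (f := fun u => u * D.q u) (by fun_prop)
  have hm0 : v₀ * D.q v₀ ≤ v * D.q v := hmax (show v₀ ∈ Icc 0 M from ⟨hp0.le, hMv⟩)
  have hvp : 0 < v * D.q v := by linarith
  refine ⟨v, pos_of_mul_pos_left hvp (D.q_nonneg v), pos_of_mul_pos_right hvp hv.1, ?_⟩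
  intro u
  rcases le_or_gt u 0 with h | h
  · have := mul_nonpos_of_nonpos_of_nonneg h (D.q_nonneg u)
    linarith
  rcases le_or_gt u M with h' | h'
  · exact hmax (show u ∈ Icc 0 M from ⟨h.le, h'⟩)
  · exact (hlarge u h'.le).trans hm0

lemma ValueDist.I_pos (D : ValueDist) {v : ℝ} (h₀ : v ∈ interior D.supp) : 0 < v := by
  obtain ⟨e, he, hI⟩ := Metric.isOpen_iff.1 isOpen_interior v h₀
  have : v - e / 2 ∈ D.supp := interior_subset (hI (by
    rw [Metric.mem_ball, Real.dist_eq, abs_lt]; constructor <;> linarith))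
  have := D.supp_subset this
  simp only [mem_Ici] at this
  linarith

/-- Key lemma. -/
lemma ValueDist.key (D : ValueDist) {α : ℝ} (hα : 0 < α) (hα1 : α < 1) (hD : D.StronglyRegular α) :
    ∃ v, 0 < v ∧ 0 < D.q v ∧ (∀ u, u * D.q u ≤ v * D.q v) ∧
      ∀ u, (D.q u) ^ (1-α) * (1 + (1-α) * (u - v) / v) ≤ (D.q v) ^ (1-α) := by
  obtain ⟨v, hv, hq, hmax⟩ := D.exists_max hα hα1 hD
  refine ⟨v, hv, hq, hmax, ?_⟩
  have hβ : 0 < 1 - α := by linarith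
  have hqc := D.q_cont
  intro u
  by_cases hI : v ∈ interior D.supp
  · have hd : HasDerivAt (fun u => u * D.q u) (1 * D.q v + v * (-(D.q v / D.h v))) v :=
      (hasDerivAt_id v).mul (D.q_deriv hD v hI)
    have hz := (show IsLocalMax (fun u => u * D.q u) v from
      Filter.Eventually.of_forall hmax).hasDerivAt_eq_zero hd
    have hh := D.h_pos v hI
    have : D.h v = v := by
      field_simp at hz
      have h3 : D.q v * (D.h v - v) = 0 := by linarith
      rcases mul_eq_zero.1 h3 with h | h
      · exact absurd h hq.ne'
      · linarith
    have := D.tangent hα1 hD hI u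
    rwa [‹D.h v = v›] at this
  rcases D.tri v hI with h | h
  · rw [D.q_zero_of v h] at hq; exact absurd hq (lt_irrefl _)
  have hq1 := D.q_one_of v h
  have hhle : ∀ w ∈ interior D.supp, D.h w ≤ w := by
    intro w hw
    by_contra! hc
    have hwp := D.I_pos hw
    have hh := D.h_pos w hw
    have h1 := D.tangent hα1 hD hw v
    rw [mul_div_assoc] at h1
    have hvw := h w hw
    have ht : -1 ≤ (v - w) / D.h w := by
      rw [le_div_iff₀ hh]; linarith
    have h2 := weak_tangent hβ (by linarith) (D.q_nonneg v) (D.q_nonneg w) ht h1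
    have h3 := hmax w
    rw [hq1] at h2 h3
    have hvw' : v < w := lt_of_le_of_ne hvw (fun e => hI (e ▸ hw))
    have h4 : (w - v) / D.h w < (w - v) / w := by
      apply div_lt_div_of_pos_left _ hwp hc; linarith
    have h5 : (v - w) / D.h w = - ((w - v) / D.h w) := by rw [← neg_div]; ring
    rw [h5] at h2
    have h6 : w * (1 - (w - v)/w) < w * D.q w := by
      apply mul_lt_mul_of_pos_left _ hwp; linarith
    have h7 : w * (1 - (w - v)/w) = v := by field_simp; ring
    linarith
  rcases le_or_gt u v with huv | huv
  · rw [hq1, D.q_one_of u (fun w hw => huv.trans (h w hw))]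
    simp only [Real.one_rpow, one_mul]
    have : (1-α) * (u - v) / v ≤ 0 := div_nonpos_of_nonpos_of_nonneg
      (mul_nonpos_of_nonneg_of_nonpos hβ.le (by linarith)) hv.le
    linarith
  -- v is the infimum
  have hva : v ∈ closure (interior D.supp) := by
    by_contra hc
    have hne := D.I_nonempty
    have hbd : BddBelow (interior D.supp) := ⟨v, h⟩
    have ha := csInf_mem_closure hne hbd
    set a := sInf (interior D.supp)
    have hva : v ≤ a := le_csInf hne h
    have hqa : D.q a = 1 := D.q_one_of a fun u hu => csInf_le hbd hu
    have := hmax a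
    rw [hqa, hq1] at this
    have : v = a := by linarith
    exact hc (this ▸ ha)
  by_contra! hc
  have hcont : ContinuousAt (fun w => (D.q u) ^ (1-α) * (1 + (1-α) * (u - w) / w) - (D.q w) ^ (1-α)) v := by
    have h1 : Continuous fun w => D.q w ^ (1-α) := hqc.rpow_const (fun _ => Or.inr hβ.le)
    have h2 : ContinuousAt (fun w => (1-α) * (u - w) / w) v := by
      apply ContinuousAt.div _ _ hv.ne' <;> fun_prop
    have h3 := h1.continuousAt (x := v)
    fun_prop
  have hev := hcont.eventually (lt_mem_nhds (show (0:ℝ) < _ from sub_pos.2 hc))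
  have hev2 := hev.and (gt_mem_nhds huv)
  obtain ⟨w, ⟨hw1, hw2⟩, hw⟩ := mem_closure_iff_nhds.1 hva _ hev2
  have h1 := D.tangent hα1 hD hw u
  have hwp := D.I_pos hw
  have hh := D.h_pos w hw
  have h2 : (1-α) * (u - w) / w ≤ (1-α) * (u - w) / D.h w := by
    apply div_le_div_of_nonneg_left _ hh (hhle w hw)
    exact mul_nonneg hβ.le (sub_nonneg.2 (le_of_lt hw2))
  have h3 := mul_le_mul_of_nonneg_left (add_le_add_right h2 1) (Real.rpow_nonneg (D.q_nonneg u) (1-α))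
  have hw1' : 0 < D.q u ^ (1 - α) * (1 + (1 - α) * (u - w) / w) - D.q w ^ (1 - α) := hw1
  linarith

lemma bern_strong {β x : ℝ} (hβ0 : 0 ≤ β) (hβ1 : β ≤ 1) (hx : 0 ≤ x) :
    x ^ β ≤ 1 + β * (x - 1) - β * (1 - β) * (x - 1)^2 / (2 * (x + 1)) := by
  set s := √x with hs
  have hs0 : 0 ≤ s := Real.sqrt_nonneg x
  have hsx : x = s * s := (Real.mul_self_sqrt hx).symm
  have h1 := rpow_bern hβ0 hβ1 hs0
  have h2 : x ^ β ≤ (1 + β * (s - 1)) ^ 2 := by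
    rw [hsx, Real.mul_rpow hs0 hs0, ← sq]
    have := Real.rpow_nonneg hs0 β
    gcongr
  have h3 : (x - 1)^2 / (2 * (x + 1)) ≤ (s - 1)^2 := by
    rw [div_le_iff₀ (by positivity)]
    have : (x - 1)^2 = (s-1)^2 * (s+1)^2 := by rw [hsx]; ring
    rw [this]
    apply mul_le_mul_of_nonneg_left _ (sq_nonneg _)
    rw [hsx]; nlinarith [sq_nonneg (s - 1)]
  have h4 : (1 + β * (s - 1)) ^ 2 = 1 + β * (x - 1) - β * (1 - β) * (s-1)^2 := by
    rw [hsx]; ring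
  have h5 := mul_le_mul_of_nonneg_left h3 (mul_nonneg hβ0 (sub_nonneg.2 hβ1))
  rw [← mul_div_assoc] at h5
  linarith

lemma loss_aux {q qs L x K : ℝ} (hqp : 0 < q) (hq1 : q ≤ 1) (hqs : 0 < qs) (hqs1 : qs ≤ 1)
    (hL0 : 0 ≤ L) (hLL : L^2 ≤ L) (h4 : (x - 1)^2 ≤ K * L)
    (h5 : (q - qs) * x = qs * (1 - L - x)) : (q - qs)^2 ≤ (8 + 8 * K) * L := by
  rcases le_or_gt (1/2) x with hh | hh
  · have h6 : ((q - qs) * x)^2 ≤ (1 - L - x)^2 := by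
      rw [h5, mul_pow]
      have : qs^2 ≤ 1 := pow_le_one₀ hqs.le hqs1
      exact mul_le_of_le_one_left (sq_nonneg _) this
    have h7 : (1 - L - x)^2 ≤ 2 * L^2 + 2 * (x-1)^2 := by
      linarith [sq_nonneg (L - (x-1)), show 2 * L^2 + 2 * (x-1)^2 - (1 - L - x)^2 = (L - (x-1))^2 by ring]
    have hx2 : 1/4 ≤ x^2 := by
      have := pow_le_pow_left₀ (by norm_num) hh 2
      norm_num at this ⊢; exact this
    have h8 : (q-qs)^2 * (1/4) ≤ ((q - qs) * x)^2 := by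
      rw [mul_pow]
      exact mul_le_mul_of_nonneg_left hx2 (sq_nonneg _)
    linarith
  · have h6 : 1/4 ≤ (x-1)^2 := by
      have := pow_le_pow_left₀ (by norm_num) (show 1/2 ≤ 1 - x by linarith) 2
      have e : (1-x)^2 = (x-1)^2 := by ring
      rw [e] at this
      norm_num at this ⊢; exact this
    have h7 : (q-qs)^2 ≤ 1 := by
      rw [sq_le_one_iff_abs_le_one, abs_le]
      constructor <;> linarith
    linarith

/-- loss lemma -/
lemma loss_lemma {α c q qs v vs K : ℝ} (hα : 0 < α) (hα1 : α < 1) (hc : 0 < c) (hc1 : c < 1)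
    (hq : c / 2 ≤ q) (hq1 : q ≤ 1) (hqs : 0 < qs) (hqs1 : qs ≤ 1) (hv : 0 ≤ v) (hvs : 0 < vs)
    (hmax : v * q ≤ vs * qs) (hK : K = 12 / (α * (1-α) * c^2))
    (hkl : q ^ (1-α) * (1 + (1-α) * (v - vs) / vs) ≤ qs ^ (1-α)) :
    (v / vs - 1)^2 ≤ K * (1 - v * q / (vs * qs)) ∧
      (q - qs)^2 ≤ (8 + 8 * K) * (1 - v * q / (vs * qs)) := by
  set L := 1 - v * q / (vs * qs) with hL
  set x := v / vs with hx
  set β := 1 - α with hβ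
  have hβ0 : 0 < β := by linarith
  have hβ1 : β ≤ 1 := by linarith
  have hqp : 0 < q := by linarith
  have hL1 : L ≤ 1 := by
    have : 0 ≤ v * q / (vs * qs) := by positivity
    linarith
  have hL0 : 0 ≤ L := by
    have : v * q / (vs * qs) ≤ 1 := by rw [div_le_one (by positivity)]; exact hmax
    linarith
  have hx0 : 0 ≤ x := by positivity
  have hxy : x * (q / qs) = 1 - L := by rw [hL, hx]; field_simp; ring
  have hxle : x ≤ 2 / c := by
    have h1 : x * q ≤ 1 := by
      rw [hx, div_mul_eq_mul_div, div_le_one hvs]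
      nlinarith
    rw [le_div_iff₀ hc]
    nlinarith
  have hc2 : 2 ≤ 2 / c := by rw [le_div_iff₀ hc]; linarith
  set A := 1 + β * (x - 1) with hA
  have hAp : 0 < A := by rw [hA]; nlinarith
  have hAle : A ≤ 2 / c := by rw [hA]; nlinarith
  have hAeq : 1 + β * (v - vs) / vs = A := by rw [hA, hx]; field_simp
  have h1 : (q/qs) ^ β * A ≤ 1 := by
    rw [Real.div_rpow hqp.le hqs.le, div_mul_eq_mul_div, div_le_one (Real.rpow_pos_of_pos hqs _), ← hAeq]
    exact hkl
  have h2 : (1 - L) * A ≤ x ^ β := by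
    have h3 : 1 - L ≤ (1 - L) ^ β := by
      have := Real.rpow_le_rpow_of_exponent_ge' (x := 1 - L) (by linarith) (by linarith) hβ0.le hβ1
      simpa using this
    calc (1 - L) * A ≤ (1 - L)^β * A := by gcongr
      _ = x ^ β * ((q/qs)^β * A) := by rw [← hxy, Real.mul_rpow hx0 (by positivity)]; ring
      _ ≤ x ^ β * 1 := by have := Real.rpow_nonneg hx0 β; gcongr
      _ = _ := mul_one _
  have h3 := bern_strong hβ0.le hβ1 hx0
  have hKp : 0 < K := by rw [hK]; positivity
  have hKe : K * (α * β * c^2) = 12 := by rw [hK]; field_simp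
  have h4 : (x - 1)^2 ≤ K * L := by
    have h5 : β * (1 - β) * (x-1)^2 / (2 * (x+1)) ≤ L * A := by linarith
    rw [div_le_iff₀ (by positivity)] at h5
    have h6 : L * A * (2 * (x+1)) ≤ L * (2/c) * (2 * (3 / c)) := by
      have : x + 1 ≤ 3 / c := by
        have : 1 ≤ 1 / c := by rw [le_div_iff₀ hc]; linarith
        have e : 3 / c = 2 / c + 1 / c := by ring
        linarith
      gcongr
    have h7 : L * (2/c) * (2 * (3 / c)) = L * (12 / c^2) := by field_simp; ring
    have h8 : β * α * (x-1)^2 ≤ L * (12 / c^2) := by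
      have : 1 - β = α := by rw [hβ]; ring
      rw [this] at h5; linarith
    have h9 : K * L = L * (12 / c^2) / (α * β) := by rw [hK]; field_simp
    rw [h9, le_div_iff₀ (by positivity)]
    linarith
  refine ⟨h4, ?_⟩
  have h5 : (q - qs) * x = qs * (1 - L - x) := by rw [← hxy]; field_simp
  have hLL : L ^ 2 ≤ L := by rw [sq]; exact mul_le_of_le_one_left hL0 hL1
  exact loss_aux hqp hq1 hqs hqs1 hL0 hLL h4 h5

lemma c_props {α : ℝ} (hα : 0 < α) (hα1 : α < 1) : 0 < α ^ ((1:ℝ)/(1-α)) ∧ α ^ ((1:ℝ)/(1-α)) < 1 ∧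
    (α ^ ((1:ℝ)/(1-α)))^(1-α) = α := by
  have hβ : 0 < 1 - α := by linarith
  refine ⟨Real.rpow_pos_of_pos hα _, Real.rpow_lt_one hα.le hα1 (by positivity), ?_⟩
  rw [← Real.rpow_mul hα.le, one_div_mul_cancel hβ.ne', Real.rpow_one]

lemma ValueDist.q_zero (D : ValueDist) {v : ℝ} (hv : v ≤ 0) : D.q v = 1 :=
  D.q_one_of v fun _ hu => hv.trans (D.I_pos hu).le

lemma c_le {α c : ℝ} (hα1 : α < 1) (hc : 0 < c) (hca : c ^ (1-α) = α) (D : ValueDist)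
    {vs : ℝ} (hvs : 0 < vs)
    (hkl : ∀ u, (D.q u) ^ (1-α) * (1 + (1-α) * (u - vs) / vs) ≤ (D.q vs) ^ (1-α)) : c ≤ D.q vs := by
  have h := hkl 0
  rw [D.q_zero le_rfl] at h
  have e : (1:ℝ) ^ (1-α) * (1 + (1-α) * (0 - vs) / vs) = c ^ (1-α) := by
    rw [hca, Real.one_rpow]; field_simp; ring
  rw [e] at h
  exact (Real.rpow_le_rpow_iff hc.le (D.q_nonneg _) (by linarith)).1 h

lemma comparator {α c : ℝ} (hα : 0 < α) (hα1 : α < 1) (hc : 0 < c) (hc1 : c < 1) (hca : c ^ (1-α) = α)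
    (D : ValueDist) (hD : D.StronglyRegular α)
    {vs : ℝ} (hvs : 0 < vs) (hmax : ∀ u, u * D.q u ≤ vs * D.q vs)
    (hkl : ∀ u, (D.q u) ^ (1-α) * (1 + (1-α) * (u - vs) / vs) ≤ (D.q vs) ^ (1-α))
    {ε : ℝ} (hε : 0 < ε) (hε1 : ε < 1) :
    ∃ v₀, 0 < v₀ ∧ c + c * (1 - c) / 4 * √ε ≤ D.q v₀ ∧ (1 - ε / 8) * (vs * D.q vs) ≤ v₀ * D.q v₀ := by
  set δ := c * (1 - c) / 4 * √ε with hδ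
  have hβ : 0 < 1 - α := by linarith
  have hc1' : 0 < 1 - c := by linarith
  have hse : √ε ≤ 1 := Real.sqrt_le_one.2 hε1.le
  have hse0 : 0 < √ε := Real.sqrt_pos.2 hε
  have hδ0 : 0 < δ := by positivity
  have hcs := c_le hα1 hc hca D hvs hkl
  have hqs : 0 < D.q vs := by linarith
  have hρ : 0 < vs * D.q vs := by positivity
  rcases le_or_gt (c + δ) (D.q vs) with h | h
  · exact ⟨vs, hvs, h, by nlinarith⟩
  have hδ4 : δ ≤ c / 4 * √ε := by
    rw [hδ]; apply mul_le_mul_of_nonneg_right _ hse0.le; nlinarith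
  have hδc : δ ≤ c / 4 := by nlinarith
  have hδ1 : c + δ < 1 := by
    have : δ ≤ c * (1-c)/4 := by rw [hδ]; exact mul_le_of_le_one_right (by positivity) hse
    nlinarith
  obtain ⟨v₀, hv₀, hq0⟩ : c + δ ∈ D.q '' Icc 0 vs := by
    apply intermediate_value_Icc' hvs.le D.q_cont.continuousOn
    rw [D.q_zero le_rfl]; exact ⟨h.le, hδ1.le⟩
  have hI : v₀ ∈ interior D.supp := by
    by_contra hI
    rcases D.tri v₀ hI with h' | h'
    · have := D.q_zero_of v₀ h'; linarith
    · have := D.q_one_of v₀ h'; linarith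
  have hv0p := D.I_pos hI
  have hh := D.h_pos v₀ hI
  refine ⟨v₀, hv0p, hq0.ge, ?_⟩
  have t0 := D.tangent hα1 hD hI 0
  have t1 := D.tangent hα1 hD hI vs
  rw [D.q_zero le_rfl, Real.one_rpow, one_mul] at t0
  rw [mul_div_assoc] at t1
  have ht : 0 ≤ (vs - v₀) / D.h v₀ := div_nonneg (by linarith [hv₀.2]) hh.le
  have w1 := weak_tangent hβ (by linarith) hqs.le (D.q_nonneg _) (by linarith) t1
  set h0 := D.h v₀ with hh0
  have w2 : D.q vs * (h0 + (vs - v₀)) ≤ D.q v₀ * h0 := by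
    have e : D.q vs * (h0 + (vs - v₀)) = D.q vs * (1 + (vs - v₀)/h0) * h0 := by field_simp
    rw [e]; gcongr
  -- bound h0
  have b1 : D.q v₀ ^ (1-α) ≤ α * (1 + (1-α) * (δ / c)) := by
    have e : c + δ = c * (1 + δ / c) := by field_simp
    rw [hq0, e, Real.mul_rpow hc.le (by positivity), hca]
    have := rpow_bern hβ.le (by linarith) (x := 1 + δ / c) (by positivity)
    have e2 : 1 + δ / c - 1 = δ / c := by ring
    rw [e2] at this
    gcongr
  have b2 : h0 * (1 - α * δ / c) ≤ v₀ := by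
    have b3 := t0.trans b1
    have e : (1-α) * (0 - v₀) / h0 = -((1-α) * v₀ / h0) := by ring
    rw [e] at b3
    have b4 : (1 - α) * (1 - α * δ / c) ≤ (1-α) * v₀ / h0 := by
      have : (1 - α) * (1 - α * δ / c) = 1 - α * (1 + (1-α) * (δ/c)) := by ring
      rw [this]; linarith
    rw [le_div_iff₀ hh] at b4
    have b5 : (1-α) * (h0 * (1 - α * δ / c)) ≤ (1-α) * v₀ := by linarith
    exact le_of_mul_le_mul_left b5 hβ
  have hs : α * δ / c ≤ δ / c := by
    apply div_le_div_of_nonneg_right _ hc.le; nlinarith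
  have hs2 : δ / c ≤ 1 / 4 := by rw [div_le_iff₀ hc]; linarith
  have b6 : h0 - v₀ ≤ 2 * (δ / c) * v₀ := by
    have b7 : h0 * (1 - δ / c) ≤ v₀ := by
      refine le_trans ?_ b2
      apply mul_le_mul_of_nonneg_left _ hh.le; linarith
    set s := δ / c
    have s0 : 0 ≤ s := by positivity
    have : h0 ≤ 2 * v₀ := by nlinarith
    nlinarith
  have b8 : vs * D.q vs - v₀ * D.q v₀ ≤ (h0 - v₀) * (D.q v₀ - D.q vs) := by nlinarith
  have b9 : (h0 - v₀) * (D.q v₀ - D.q vs) ≤ 2 * (δ/c) * v₀ * δ := by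
    calc _ ≤ 2 * (δ / c) * v₀ * (D.q v₀ - D.q vs) := by
          apply mul_le_mul_of_nonneg_right b6; linarith
      _ ≤ _ := by
          apply mul_le_mul_of_nonneg_left _ (by positivity); linarith
  have b10 : v₀ * c ≤ vs * D.q vs := mul_le_mul hv₀.2 hcs hc.le hvs.le
  have b11 : δ * δ ≤ c^2/16 * ε := by
    have : δ * δ ≤ (c / 4 * √ε) * (c / 4 * √ε) := mul_le_mul hδ4 hδ4 hδ0.le (by positivity)
    have e : (c / 4 * √ε) * (c / 4 * √ε) = c^2/16 * (√ε * √ε) := by ring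
    rw [e, Real.mul_self_sqrt hε.le] at this
    exact this
  have b12 : 2 * (δ/c) * v₀ * δ ≤ ε / 8 * (vs * D.q vs) := by
    calc 2 * (δ/c) * v₀ * δ = 2 / c * v₀ * (δ * δ) := by ring
      _ ≤ 2 / c * v₀ * (c^2/16 * ε) := by gcongr
      _ = ε / 8 * (v₀ * c) := by field_simp; ring
      _ ≤ _ := mul_le_mul_of_nonneg_left b10 (by positivity)
  linarith

lemma chernoff (μ : Measure ℝ) [IsProbabilityMeasure μ] {X : ℝ → ℝ} (hX : Measurable X) {b l σ : ℝ}
    (hb : 0 < b) (hl : 0 < l) (hσ : 0 ≤ σ) (hXb : ∀ t, |X t| ≤ b) (hmean : ∫ t, X t ∂μ ≤ -l)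
    (hvar : ∫ t, (X t)^2 ∂μ ≤ σ) (n : ℕ) :
    (Measure.pi fun _ : Fin n => μ).real {t | -b ≤ ∑ j, X (t j)} ≤
      Real.exp 1 * Real.exp (-(n * (l^2 / (4 * (σ + b * l))))) := by
  set lam := l / (2 * (σ + b * l)) with hlam
  have hden : 0 < σ + b * l := by positivity
  have hlam0 : 0 < lam := by positivity
  have hlb : lam * b ≤ 1 := by
    rw [hlam, div_mul_eq_mul_div, div_le_one (by positivity)]; nlinarith
  have hXint : Integrable X μ := Integrable.of_bound hX.aestronglyMeasurable b
    (Filter.Eventually.of_forall hXb)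
  have hX2int : Integrable (fun t => (X t)^2) μ := Integrable.of_bound
    (hX.pow_const 2).aestronglyMeasurable (b^2) (Filter.Eventually.of_forall (fun t => by
      rw [Real.norm_eq_abs, abs_pow]; exact pow_le_pow_left₀ (abs_nonneg _) (hXb t) 2))
  have hEint : Integrable (fun t => Real.exp (lam * X t)) μ := Integrable.of_bound
    (by fun_prop) (Real.exp (lam * b)) (Filter.Eventually.of_forall (fun t => by
      rw [Real.norm_eq_abs, abs_of_pos (Real.exp_pos _)]
      exact Real.exp_le_exp.2 (mul_le_mul_of_nonneg_left ((le_abs_self _).trans (hXb t)) hlam0.le)))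
  have hE : ∫ t, Real.exp (lam * X t) ∂μ ≤ Real.exp (-(l^2 / (4 * (σ + b * l)))) := by
    have h1 : ∫ t, Real.exp (lam * X t) ∂μ ≤ ∫ t, (1 + lam * X t + lam^2 * (X t)^2) ∂μ := by
      apply integral_mono hEint
      · exact ((integrable_const 1).add (hXint.const_mul lam)).add (hX2int.const_mul _)
      intro t
      have : |lam * X t| ≤ 1 := by
        rw [abs_mul, abs_of_pos hlam0]
        exact (mul_le_mul_of_nonneg_left (hXb t) hlam0.le).trans hlb
      have := Real.abs_exp_sub_one_sub_id_le this
      have := (abs_le.1 this).2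
      simp only
      nlinarith
    have h2 : ∫ t, (1 + lam * X t + lam^2 * (X t)^2) ∂μ = 1 + lam * ∫ t, X t ∂μ + lam^2 * ∫ t, (X t)^2 ∂μ := by
      have hi : Integrable (fun t => 1 + lam * X t) μ := (integrable_const 1).add (hXint.const_mul lam)
      rw [integral_add hi (hX2int.const_mul _),
        integral_add (integrable_const 1) (hXint.const_mul lam), integral_const_mul, integral_const_mul]
      simp
    have h3 : lam * ∫ t, X t ∂μ ≤ lam * (-l) := mul_le_mul_of_nonneg_left hmean hlam0.le
    have h4 : lam^2 * ∫ t, (X t)^2 ∂μ ≤ lam^2 * σ := mul_le_mul_of_nonneg_left hvar (by positivity)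
    have h5 : lam * l - lam^2 * σ ≥ l^2 / (4 * (σ + b * l)) := by
      have e1 : lam^2 * (σ + b*l) = l^2 / (4 * (σ + b * l)) := by rw [hlam]; field_simp; ring
      have e2 : lam * l = 2 * (lam^2 * (σ + b*l)) := by rw [hlam]; field_simp
      have : lam^2 * σ ≤ lam^2 * (σ + b * l) := by
        apply mul_le_mul_of_nonneg_left _ (by positivity); nlinarith [mul_pos hb hl]
      linarith
    have h6 := Real.add_one_le_exp (-(l^2 / (4 * (σ + b * l))))
    linarith
  set P := Measure.pi fun _ : Fin n => μ
  have hset : {t : Fin n → ℝ | -b ≤ ∑ j, X (t j)} ⊆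
      {t | Real.exp (-(lam * b)) ≤ ∏ j, Real.exp (lam * X (t j))} := by
    intro t ht
    have ht' : -b ≤ ∑ j, X (t j) := ht
    change Real.exp (-(lam * b)) ≤ ∏ j, Real.exp (lam * X (t j))
    rw [← Real.exp_sum, ← Finset.mul_sum]
    apply Real.exp_le_exp.2
    nlinarith
  have hint : Integrable (fun t : Fin n → ℝ => ∏ j, Real.exp (lam * X (t j))) P :=
    Integrable.fintype_prod (f := fun _ : Fin n => fun x => Real.exp (lam * X x)) (fun _ => hEint)
  have hmk := mul_meas_ge_le_integral_of_nonneg (μ := P)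
    (f := fun t : Fin n → ℝ => ∏ j, Real.exp (lam * X (t j)))
    (Filter.Eventually.of_forall (fun t => Finset.prod_nonneg fun _ _ => (Real.exp_pos _).le))
    hint (Real.exp (-(lam * b)))
  have hprod : ∫ t : Fin n → ℝ, ∏ j, Real.exp (lam * X (t j)) ∂P = (∫ t, Real.exp (lam * X t) ∂μ)^n := by
    have := integral_fintype_prod_eq_pow (ι := Fin n) (μ := μ) (fun x => Real.exp (lam * X x))
    simpa using this
  rw [hprod] at hmk
  have h0 : 0 ≤ ∫ t, Real.exp (lam * X t) ∂μ := integral_nonneg fun _ => (Real.exp_pos _).le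
  have h7 : (∫ t, Real.exp (lam * X t) ∂μ)^n ≤ Real.exp (-(n * (l^2 / (4 * (σ + b * l))))) := by
    calc _ ≤ (Real.exp (-(l^2 / (4 * (σ + b * l)))))^n := pow_le_pow_left₀ h0 hE n
      _ = _ := by rw [← Real.exp_nat_mul]; congr 1; ring
  have h8 := measureReal_mono (μ := P) hset
  have h9 : Real.exp (-1) ≤ Real.exp (-(lam * b)) := Real.exp_le_exp.2 (by linarith)
  set A := P.real {t | Real.exp (-(lam * b)) ≤ ∏ j, Real.exp (lam * X (t j))}
  have hA : 0 ≤ A := measureReal_nonneg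
  have h10 : Real.exp (-1) * A ≤ Real.exp (-(n * (l^2 / (4 * (σ + b * l))))) :=
    (mul_le_mul_of_nonneg_right h9 hA).trans (hmk.trans h7)
  refine h8.trans ?_
  calc A = Real.exp 1 * (Real.exp (-1) * A) := by
        rw [← mul_assoc, ← Real.exp_add]; simp
    _ ≤ _ := mul_le_mul_of_nonneg_left h10 (Real.exp_pos _).le

lemma fub (μ : Measure ℝ) [IsProbabilityMeasure μ] (n : ℕ) (i : Fin (n+1)) (B : Set (Fin (n+1) → ℝ))
    (hB : MeasurableSet B) {e : ℝ} (he : 0 ≤ e)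
    (h : ∀ v, (Measure.pi fun _ : Fin n => μ).real {t | i.insertNth v t ∈ B} ≤ e) :
    (Measure.pi fun _ : Fin (n+1) => μ).real B ≤ e := by
  have hmp := (measurePreserving_piFinSuccAbove (fun _ : Fin (n+1) => μ) i).symm
  have h1 : (Measure.pi fun _ : Fin (n+1) => μ) B ≤ ENNReal.ofReal e := by
    rw [← hmp.measure_preimage hB.nullMeasurableSet]
    rw [Measure.prod_apply (hmp.measurable hB)]
    calc _ ≤ ∫⁻ v, ENNReal.ofReal e ∂μ := by
          apply lintegral_mono
          intro v
          rw [ENNReal.le_ofReal_iff_toReal_le (measure_ne_top _ _) he]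
          exact h v
      _ = _ := by simp
  exact ENNReal.toReal_le_of_le_ofReal he h1

/-- indicator of `u ≤ t` -/
noncomputable def ind (u t : ℝ) : ℝ := if u ≤ t then 1 else 0

lemma ind_nonneg (u t : ℝ) : 0 ≤ ind u t := by unfold ind; split_ifs <;> norm_num
lemma ind_le (u t : ℝ) : ind u t ≤ 1 := by unfold ind; split_ifs <;> norm_num

lemma ind_meas2 : Measurable fun p : ℝ × ℝ => ind p.1 p.2 := by
  unfold ind
  exact Measurable.ite (measurableSet_le measurable_fst measurable_snd) measurable_const measurable_const

lemma ind_meas (u : ℝ) : Measurable (ind u) :=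
  ind_meas2.comp (measurable_const.prodMk measurable_id)

lemma ind_int (D : ValueDist) (u : ℝ) : Integrable (ind u) D.μ := by
  have := D.isProb
  exact Integrable.of_bound (ind_meas u).aestronglyMeasurable 1 (Filter.Eventually.of_forall fun t => by
    rw [Real.norm_eq_abs, abs_of_nonneg (ind_nonneg _ _)]; exact ind_le _ _)

lemma integral_ind (D : ValueDist) (u : ℝ) : ∫ t, ind u t ∂D.μ = D.q u := by
  have : ind u = (Ici u).indicator 1 := by
    ext t; simp [ind, Set.indicator]
  rw [this, integral_indicator_one measurableSet_Ici, D.q_eq']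

lemma integral_abs_ind (D : ValueDist) (u v : ℝ) :
    ∫ t, |ind u t - ind v t| ∂D.μ = |D.q u - D.q v| := by
  wlog h : u ≤ v generalizing u v
  · have := this v u (le_of_not_ge h)
    simp_rw [abs_sub_comm (ind u _), abs_sub_comm (D.q u)]; exact this
  have h1 : ∀ t, |ind u t - ind v t| = ind u t - ind v t := by
    intro t
    apply abs_of_nonneg
    unfold ind
    by_cases h2 : v ≤ t
    · simp [h2, h.trans h2]
    · simp only [h2, if_false]; split_ifs <;> norm_num
  simp_rw [h1]
  rw [integral_sub (ind_int D u) (ind_int D v), integral_ind, integral_ind,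
    abs_of_nonneg (sub_nonneg.2 (D.q_anti h))]

/-- real-valued count -/
noncomputable def cnt {m : ℕ} (s : Fin m → ℝ) (u : ℝ) : ℝ := ∑ j, ind u (s j)

lemma cnt_eq {m : ℕ} (s : Fin m → ℝ) (u : ℝ) : (empCount s u : ℝ) = cnt s u := by
  unfold empCount cnt ind
  rw [Set.ncard_eq_toFinset_card', Finset.sum_boole]
  congr 2
  ext j; simp

lemma cnt_nonneg {m : ℕ} (s : Fin m → ℝ) (u : ℝ) : 0 ≤ cnt s u :=
  Finset.sum_nonneg fun _ _ => ind_nonneg _ _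

lemma cnt_insert {n : ℕ} (i : Fin (n+1)) (v : ℝ) (t : Fin n → ℝ) (u : ℝ) :
    cnt (i.insertNth v t : Fin (n+1) → ℝ) u = ind u v + cnt t u := by
  unfold cnt
  rw [Fin.sum_univ_succAbove _ i]
  simp

/-- constants -/
noncomputable def KK (α c : ℝ) : ℝ := 12 / (α * (1-α) * c^2)
noncomputable def K3 (α c : ℝ) : ℝ := (16 * (8 + 8 * KK α c) + 5 * KK α c) / c^2 + 1 / c
noncomputable def kap (α c : ℝ) : ℝ := min (min (1 / (64 * K3 α c)) (c^2/24)) ((c * (1-c)/4)^2/8)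

lemma kap_pos {α c : ℝ} (hα : 0 < α) (hα1 : α < 1) (hc : 0 < c) (hc1 : c < 1) : 0 < kap α c := by
  have h1 : 0 < 1 - α := by linarith
  have h2 : 0 < 1 - c := by linarith
  unfold kap K3 KK
  positivity

lemma exp_bd {n : ℕ} {x y : ℝ} (h : y ≤ x) :
    Real.exp 1 * Real.exp (-(n * x)) ≤ Real.exp 1 * Real.exp (-(n * y)) := by
  have := mul_le_mul_of_nonneg_left h (Nat.cast_nonneg (α := ℝ) n)
  gcongr

lemma low_q (D : ValueDist) {c v : ℝ} (hc : 0 < c) (hc1 : c < 1) (hq : D.q v < c/2) (n : ℕ) :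
    (Measure.pi fun _ : Fin n => D.μ).real {t | c * (n+1) ≤ cnt t v + 1} ≤
      Real.exp 1 * Real.exp (-(n * (c^2/24))) := by
  have := D.isProb
  have h := chernoff D.μ (X := fun t => ind v t - c) ((ind_meas v).sub_const c) (b := 1) (l := c/2) (σ := 1)
    one_pos (by positivity) zero_le_one (fun t => by
      rw [abs_le]; constructor <;> linarith [ind_nonneg v t, ind_le v t]) (by
      rw [integral_sub (ind_int D v) (integrable_const _), integral_ind]; simp; linarith) (by
      have : ∫ t, (ind v t - c)^2 ∂D.μ ≤ ∫ t, (1:ℝ) ∂D.μ := by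
        apply integral_mono_of_nonneg
        · exact Filter.Eventually.of_forall fun t => sq_nonneg _
        · exact integrable_const _
        · refine Filter.Eventually.of_forall fun t => ?_
          change (ind v t - c)^2 ≤ 1
          rw [sq_le_one_iff_abs_le_one, abs_le]; constructor <;> linarith [ind_nonneg v t, ind_le v t]
      simpa using this) n
  refine (measureReal_mono ?_).trans (h.trans (exp_bd ?_))
  · intro t ht
    have ht' : c * (n+1) ≤ cnt t v + 1 := ht
    change -1 ≤ ∑ j, (ind v (t j) - c)
    rw [Finset.sum_sub_distrib]
    simp only [cnt] at ht'
    simp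
    linarith
  · rw [div_le_div_iff₀ (by norm_num) (by positivity)]
    nlinarith [sq_nonneg c, mul_pos hc hc]

lemma guard_ok (D : ValueDist) {c v l : ℝ} (hc : 0 < c) (hc1 : c < 1) (hl : 0 < l) (hq : c + l ≤ D.q v) (n : ℕ) :
    (Measure.pi fun _ : Fin n => D.μ).real {t | cnt t v < c * n} ≤
      Real.exp 1 * Real.exp (-(n * (l^2/8))) := by
  have := D.isProb
  have h := chernoff D.μ (X := fun t => c - ind v t) ((ind_meas v).const_sub c) (b := 1) (l := l) (σ := 1)
    one_pos (by positivity) zero_le_one (fun t => by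
      rw [abs_le]; constructor <;> linarith [ind_nonneg v t, ind_le v t]) (by
      rw [integral_sub (integrable_const _) (ind_int D v), integral_ind]; simp; linarith) (by
      have : ∫ t, (c - ind v t)^2 ∂D.μ ≤ ∫ t, (1:ℝ) ∂D.μ := by
        apply integral_mono_of_nonneg
        · exact Filter.Eventually.of_forall fun t => sq_nonneg _
        · exact integrable_const _
        · refine Filter.Eventually.of_forall fun t => ?_
          change (c - ind v t)^2 ≤ 1
          rw [sq_le_one_iff_abs_le_one, abs_le]; constructor <;> linarith [ind_nonneg v t, ind_le v t]
      simpa using this) n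
  refine (measureReal_mono ?_).trans (h.trans (exp_bd ?_))
  · intro t ht
    have ht' : cnt t v < c * n := ht
    change -1 ≤ ∑ j, (c - ind v (t j))
    rw [Finset.sum_sub_distrib]
    simp only [cnt] at ht'
    simp
    linarith
  · have : l ≤ 1 := by linarith [D.q_le v]
    rw [div_le_div_iff₀ (by norm_num) (by positivity)]
    nlinarith [sq_nonneg l]

/-- the deterministic estimate behind the bad price bound -/
lemma mid_est {α c : ℝ} (hα : 0 < α) (hα1 : α < 1) (hc : 0 < c) (hc1 : c < 1)
    (D : ValueDist) {vs : ℝ} (hvs : 0 < vs) (hmax : ∀ u, u * D.q u ≤ vs * D.q vs)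
    (hkl : ∀ u, (D.q u) ^ (1-α) * (1 + (1-α) * (u - vs) / vs) ≤ (D.q vs) ^ (1-α)) (hcs : c ≤ D.q vs)
    {ε : ℝ} (hε : 0 < ε) {v₀ : ℝ} (hv₀ : 0 < v₀) (hq₀ : c ≤ D.q v₀)
    (hR₀ : (1 - ε / 8) * (vs * D.q vs) ≤ v₀ * D.q v₀)
    {v : ℝ} (hv : 0 < v) (hq : c / 2 ≤ D.q v) (hbad : v * D.q v < (1 - ε/2) * (vs * D.q vs)) {L ρ : ℝ}
    (hρ : ρ = vs * D.q vs) (hL : L = 1 - v * D.q v / ρ) :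
    2 * v^2 * |D.q v - D.q v₀| + 2 * (v - v₀)^2 ≤
      ρ^2 * ((16 * (8 + 8 * KK α c) + 5 * KK α c) / c^2) * √L := by
  have hqs : 0 < D.q vs := by linarith
  have hρp : 0 < ρ := by rw [hρ]; positivity
  have hKp : 0 < KK α c := by unfold KK; have : 0 < 1 - α := by linarith
                              positivity
  obtain ⟨l1, l2⟩ := loss_lemma hα hα1 hc hc1 hq (D.q_le v) hqs (D.q_le vs) hv.le hvs (hmax v) (K := KK α c) rfl (hkl v)
  obtain ⟨m1, m2⟩ := loss_lemma hα hα1 hc hc1 (by linarith) (D.q_le v₀) hqs (D.q_le vs) hv₀.le hvs (hmax v₀) (K := KK α c) rfl (hkl v₀)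
  rw [← hρ] at l1 l2 m1 m2 hbad hR₀
  rw [← hL] at l1 l2
  set K := KK α c
  have hLe : ε / 2 < L := by
    have : v * D.q v / ρ < 1 - ε/2 := by rw [div_lt_iff₀ hρp]; exact hbad
    linarith
  have hL0 : 0 < L := by linarith
  have hL1 : L ≤ 1 := by
    have : 0 ≤ v * D.q v / ρ := div_nonneg (mul_nonneg hv.le (D.q_nonneg v)) hρp.le
    linarith
  have hM : 1 - v₀ * D.q v₀ / ρ ≤ L / 4 := by
    have : 1 - ε / 8 ≤ v₀ * D.q v₀ / ρ := by rw [le_div_iff₀ hρp]; exact hR₀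
    linarith
  have m1' : (v₀ / vs - 1)^2 ≤ K * (L/4) := m1.trans (mul_le_mul_of_nonneg_left hM hKp.le)
  have m2' : (D.q v₀ - D.q vs)^2 ≤ (8 + 8 * K) * (L/4) := m2.trans (mul_le_mul_of_nonneg_left hM (by positivity))
  have hsL : √L * √L = L := Real.mul_self_sqrt hL0.le
  have hsL0 : 0 < √L := Real.sqrt_pos.2 hL0
  have hsL1 : √L ≤ 1 := Real.sqrt_le_one.2 hL1
  have hLs : L ≤ √L := by nlinarith
  have a1 : |D.q v - D.q v₀| ≤ 2 * (8 + 8 * K) * √L := by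
    apply abs_le_of_sq_le_sq _ (by positivity)
    have e : (2 * (8 + 8 * K) * √L)^2 = 4 * (8+8*K) * ((8 + 8 * K) * (√L * √L)) := by ring
    rw [e, hsL]
    have e2 : (D.q v - D.q v₀)^2 ≤ 2 * (D.q v - D.q vs)^2 + 2 * (D.q v₀ - D.q vs)^2 := by
      linarith [sq_nonneg ((D.q v - D.q vs) + (D.q v₀ - D.q vs)),
        show 2 * (D.q v - D.q vs)^2 + 2 * (D.q v₀ - D.q vs)^2 - (D.q v - D.q v₀)^2
          = ((D.q v - D.q vs) + (D.q v₀ - D.q vs))^2 by ring]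
    have e3 : 0 ≤ (8+8*K) * L := by positivity
    have e4 : (8+8*K) * L ≤ (8 + 8 * K) * ((8+8*K) * L) := le_mul_of_one_le_left e3 (by linarith)
    linarith
  have a2 : (v - v₀)^2 ≤ (ρ/c)^2 * (5/2 * K * L) := by
    have e : (v - v₀)^2 = vs^2 * ((v/vs - 1) - (v₀/vs - 1))^2 := by field_simp; ring
    have e2 : ((v/vs - 1) - (v₀/vs - 1))^2 ≤ 2 * (v/vs-1)^2 + 2 * (v₀/vs-1)^2 := by
      nlinarith [sq_nonneg ((v/vs - 1) + (v₀/vs - 1))]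
    have e3 : vs ≤ ρ / c := by rw [le_div_iff₀ hc, hρ]; exact mul_le_mul_of_nonneg_left hcs hvs.le
    rw [e]
    apply mul_le_mul (pow_le_pow_left₀ hvs.le e3 2) _ (sq_nonneg _) (sq_nonneg _)
    linarith
  have a3 : v ≤ 2 * ρ / c := by
    rw [le_div_iff₀ hc]
    have := hmax v
    rw [← hρ] at this
    nlinarith
  have a4 : v^2 ≤ (2 * ρ / c)^2 := pow_le_pow_left₀ hv.le a3 2
  calc 2 * v^2 * |D.q v - D.q v₀| + 2 * (v - v₀)^2
      ≤ 2 * (2 * ρ / c)^2 * (2 * (8 + 8 * K) * √L) + 2 * ((ρ/c)^2 * (5/2 * K * √L)) := by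
        have a5 : (ρ/c)^2 * (5/2 * K * L) ≤ (ρ/c)^2 * (5/2 * K * √L) := by
          apply mul_le_mul_of_nonneg_left _ (sq_nonneg _)
          exact mul_le_mul_of_nonneg_left hLs (by positivity)
        have a6 : 2 * v^2 * |D.q v - D.q v₀| ≤ 2 * (2 * ρ / c)^2 * (2 * (8 + 8 * K) * √L) :=
          mul_le_mul (by linarith) a1 (abs_nonneg _) (by positivity)
        linarith
    _ = _ := by field_simp; ring

lemma ind_pt (v v₀ t : ℝ) :
    (v * ind v t - v₀ * ind v₀ t)^2 ≤ 2 * v^2 * |ind v t - ind v₀ t| + 2 * (v - v₀)^2 := by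
  unfold ind
  by_cases h1 : v ≤ t <;> by_cases h2 : v₀ ≤ t <;> simp only [h1, h2, if_true, if_false]
  · simp; nlinarith [sq_nonneg (v - v₀)]
  · simp; nlinarith [sq_nonneg (v - v₀), sq_nonneg v]
  · simp; nlinarith [sq_nonneg (2 * v - v₀)]
  · simp; nlinarith [sq_nonneg (v - v₀)]

set_option maxHeartbeats 2000000 in
lemma high_q {α c : ℝ} (hα : 0 < α) (hα1 : α < 1) (hc : 0 < c) (hc1 : c < 1)
    (D : ValueDist) {vs : ℝ} (hvs : 0 < vs) (hmax : ∀ u, u * D.q u ≤ vs * D.q vs)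
    (hkl : ∀ u, (D.q u) ^ (1-α) * (1 + (1-α) * (u - vs) / vs) ≤ (D.q vs) ^ (1-α)) (hcs : c ≤ D.q vs)
    {ε : ℝ} (hε : 0 < ε) {v₀ : ℝ} (hv₀ : 0 < v₀) (hq₀ : c ≤ D.q v₀)
    (hR₀ : (1 - ε / 8) * (vs * D.q vs) ≤ v₀ * D.q v₀)
    {v : ℝ} (hv : 0 < v) (hq : c / 2 ≤ D.q v) (hbad : v * D.q v < (1 - ε/2) * (vs * D.q vs)) (n : ℕ) :
    (Measure.pi fun _ : Fin n => D.μ).real {t | v₀ * cnt t v₀ ≤ v * (cnt t v + 1)} ≤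
      Real.exp 1 * Real.exp (-(n * (1 / (64 * K3 α c) * (ε * √ε)))) := by
  have := D.isProb
  obtain ⟨ρ, hρ⟩ : ∃ ρ, ρ = vs * D.q vs := ⟨_, rfl⟩
  obtain ⟨L, hL⟩ : ∃ L, L = 1 - v * D.q v / ρ := ⟨_, rfl⟩
  have hest := mid_est hα hα1 hc hc1 D hvs hmax hkl hcs hε hv₀ hq₀ hR₀ hv hq hbad hρ hL
  have hqs : 0 < D.q vs := by linarith
  have hρp : 0 < ρ := by rw [hρ]; positivity
  have hKp : 0 < KK α c := by unfold KK; have : 0 < 1 - α := by linarith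
                              positivity
  rw [← hρ] at hbad hR₀
  simp_rw [← hρ] at hmax
  have hLe : ε / 2 < L := by
    have : v * D.q v / ρ < 1 - ε/2 := by rw [div_lt_iff₀ hρp]; exact hbad
    linarith
  have hL0 : 0 < L := by linarith
  have hL1 : L ≤ 1 := by
    have : 0 ≤ v * D.q v / ρ := div_nonneg (mul_nonneg hv.le (D.q_nonneg v)) hρp.le
    linarith
  have hvb : v ≤ 2 * ρ / c := by
    rw [le_div_iff₀ hc]
    have := hmax v
    nlinarith
  have hvb0 : v₀ ≤ 2 * ρ / c := by
    rw [le_div_iff₀ hc]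
    have := hmax v₀
    nlinarith
  have hvq : v * D.q v = ρ * (1 - L) := by rw [hL]; field_simp; ring
  have hsL : √L * √L = L := Real.mul_self_sqrt hL0.le
  have hsL0 : 0 < √L := Real.sqrt_pos.2 hL0
  have hsL1 : √L ≤ 1 := Real.sqrt_le_one.2 hL1
  have hLs : L ≤ √L := by nlinarith
  set σ := ρ^2 * ((16 * (8 + 8 * KK α c) + 5 * KK α c) / c^2) * √L with hσ
  have hσ0 : 0 ≤ σ := by positivity
  have i1 : Integrable (fun t => v * ind v t) D.μ := (ind_int D v).const_mul v
  have i2 : Integrable (fun t => v₀ * ind v₀ t) D.μ := (ind_int D v₀).const_mul v₀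
  have h := chernoff D.μ (X := fun t => v * ind v t - v₀ * ind v₀ t)
    (((ind_meas v).const_mul v).sub ((ind_meas v₀).const_mul v₀)) (b := 2 * ρ / c) (l := ρ * L / 2) (σ := σ)
    (by positivity) (by positivity) hσ0 (fun t => by
      have p1 : 0 ≤ v * ind v t := mul_nonneg hv.le (ind_nonneg _ _)
      have p2 : 0 ≤ v₀ * ind v₀ t := mul_nonneg hv₀.le (ind_nonneg _ _)
      have p3 : v * ind v t ≤ v := mul_le_of_le_one_right hv.le (ind_le _ _)
      have p4 : v₀ * ind v₀ t ≤ v₀ := mul_le_of_le_one_right hv₀.le (ind_le _ _)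
      rw [abs_le]; constructor <;> linarith) (by
      rw [integral_sub i1 i2, integral_const_mul, integral_const_mul, integral_ind, integral_ind, hvq]
      nlinarith) (by
      have i3 : Integrable (fun t => |ind v t - ind v₀ t|) D.μ := ((ind_int D v).sub (ind_int D v₀)).abs
      have : ∫ t, (v * ind v t - v₀ * ind v₀ t)^2 ∂D.μ ≤
          ∫ t, (2 * v^2 * |ind v t - ind v₀ t| + 2 * (v - v₀)^2) ∂D.μ := by
        apply integral_mono_of_nonneg
        · exact Filter.Eventually.of_forall fun t => sq_nonneg _
        · exact (i3.const_mul _).add (integrable_const _)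
        · refine Filter.Eventually.of_forall fun t => ?_
          change (v * ind v t - v₀ * ind v₀ t)^2 ≤ 2 * v^2 * |ind v t - ind v₀ t| + 2 * (v - v₀)^2
          exact ind_pt _ _ _
      rw [integral_add (i3.const_mul _) (integrable_const _), integral_const_mul, integral_abs_ind] at this
      simp only [integral_const, probReal_univ, one_smul] at this
      exact this.trans hest) n
  refine (measureReal_mono ?_).trans (h.trans (exp_bd ?_))
  · intro t ht
    have ht' : v₀ * cnt t v₀ ≤ v * (cnt t v + 1) := ht
    change -(2 * ρ / c) ≤ ∑ j, (v * ind v (t j) - v₀ * ind v₀ (t j))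
    rw [Finset.sum_sub_distrib, ← Finset.mul_sum, ← Finset.mul_sum]
    simp only [cnt] at ht'
    linarith
  · have hK3 : 0 < K3 α c := by unfold K3; positivity
    have e1 : σ + 2 * ρ / c * (ρ * L / 2) ≤ ρ^2 * K3 α c * √L := by
      have : 2 * ρ / c * (ρ * L / 2) ≤ ρ^2 * (1/c) * √L := by
        have e : 2 * ρ / c * (ρ * L / 2) = ρ^2 * (1/c) * L := by ring
        rw [e]; exact mul_le_mul_of_nonneg_left hLs (by positivity)
      have e' : ρ^2 * K3 α c * √L = σ + ρ^2 * (1/c) * √L := by rw [hσ, K3]; ring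
      rw [e']
      linarith
    have e2 : (ρ * L / 2)^2 / (4 * (ρ^2 * K3 α c * √L)) ≤ (ρ * L / 2)^2 / (4 * (σ + 2 * ρ / c * (ρ * L / 2))) := by
      apply div_le_div_of_nonneg_left (sq_nonneg _) (by positivity)
      linarith
    refine le_trans ?_ e2
    have e3 : (ρ * L / 2)^2 / (4 * (ρ^2 * K3 α c * √L)) = 1 / (16 * K3 α c) * (L * √L) := by
      field_simp
      linarith [hsL, sq (√L)]
    rw [e3]
    have e4 : √ε / 2 ≤ √L := by
      apply Real.le_sqrt_of_sq_le
      rw [div_pow, Real.sq_sqrt hε.le]; linarith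
    have e5 : ε / 2 * (√ε / 2) ≤ L * √L := mul_le_mul hLe.le e4 (by positivity) hL0.le
    have e6 : 1 / (64 * K3 α c) * (ε * √ε) = 1 / (16 * K3 α c) * (ε / 2 * (√ε / 2)) := by
      field_simp; norm_num
    rw [e6]
    exact mul_le_mul_of_nonneg_left e5 (by positivity)

/-- bundled context -/
structure Ctx (α c vs v₀ ε : ℝ) (D : ValueDist) : Prop where
  hα : 0 < α
  hα1 : α < 1
  hc : 0 < c
  hc1 : c < 1
  hvs : 0 < vs
  hmax : ∀ u, u * D.q u ≤ vs * D.q vs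
  hkl : ∀ u, (D.q u) ^ (1-α) * (1 + (1-α) * (u - vs) / vs) ≤ (D.q vs) ^ (1-α)
  hcs : c ≤ D.q vs
  hε : 0 < ε
  hε1 : ε ≤ 1
  hv₀ : 0 < v₀
  hq₀ : c + c * (1-c)/4 * √ε ≤ D.q v₀
  hR₀ : (1 - ε / 8) * (vs * D.q vs) ≤ v₀ * D.q v₀

lemma fix_v {α c vs v₀ ε : ℝ} {D : ValueDist} (H : Ctx α c vs v₀ ε D) {v : ℝ} (hv : 0 < v)
    (hbad : v * D.q v < (1 - ε/2) * (vs * D.q vs)) (n : ℕ) :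
    (Measure.pi fun _ : Fin n => D.μ).real
      {t | v₀ * cnt t v₀ ≤ v * (cnt t v + 1) ∧ c * (n+1) ≤ cnt t v + 1} ≤
      Real.exp 1 * Real.exp (-(n * (kap α c * (ε * √ε)))) := by
  have := D.isProb
  obtain ⟨hα, hα1, hc, hc1, hvs, hmax, hkl, hcs, hε, hε1, hv₀, hq₀, hR₀⟩ := H
  have hs : √ε ≤ 1 := Real.sqrt_le_one.2 hε1
  have hs0 : 0 ≤ √ε := Real.sqrt_nonneg _
  have hes : ε * √ε ≤ 1 := mul_le_one₀ hε1 hs0 hs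
  have hes0 : 0 ≤ ε * √ε := by positivity
  by_cases hq : D.q v < c / 2
  · refine (measureReal_mono ?_).trans ((low_q D hc hc1 hq n).trans (exp_bd ?_))
    · intro t ht; exact ht.2
    · have h1 : kap α c ≤ c^2/24 := (min_le_left _ _).trans (min_le_right _ _)
      have := (kap_pos hα hα1 hc hc1).le
      nlinarith
  · have hq₀' : c ≤ D.q v₀ := by
      have : 0 ≤ c * (1-c)/4 * √ε := by
        have : 0 < 1 - c := by linarith
        positivity
      linarith
    refine (measureReal_mono ?_).trans ((high_q hα hα1 hc hc1 D hvs hmax hkl hcs hε hv₀ hq₀' hR₀ hv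
      (not_lt.1 hq) hbad n).trans (exp_bd ?_))
    · intro t ht; exact ht.1
    · have h1 : kap α c ≤ 1 / (64 * K3 α c) := (min_le_left _ _).trans (min_le_left _ _)
      exact mul_le_mul_of_nonneg_right h1 hes0

/-- bad event for sample i -/
def BadI (D : ValueDist) (c v₀ θ : ℝ) {m : ℕ} (i : Fin m) : Set (Fin m → ℝ) :=
  {s | s i * D.q (s i) < θ ∧ 0 < s i ∧ v₀ * cnt s v₀ ≤ s i * cnt s (s i) ∧ c * m ≤ cnt s (s i)}

lemma cnt_meas {m : ℕ} {g : (Fin m → ℝ) → ℝ} (hg : Measurable g) : Measurable fun s => cnt s (g s) := by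
  unfold cnt
  apply Finset.measurable_sum
  intro j _
  exact ind_meas2.comp (hg.prodMk (measurable_pi_apply j))

lemma BadI_meas (D : ValueDist) (c v₀ θ : ℝ) {m : ℕ} (i : Fin m) : MeasurableSet (BadI D c v₀ θ i) := by
  have h0 : Measurable fun s : Fin m → ℝ => s i := measurable_pi_apply i
  have h1 : Measurable D.q := D.q_cont.measurable
  have h2 := cnt_meas h0
  have h3 : Measurable fun s : Fin m → ℝ => cnt s v₀ := cnt_meas measurable_const
  unfold BadI
  refine (measurableSet_lt (h0.mul (h1.comp h0)) measurable_const).inter ?_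
  refine (measurableSet_lt measurable_const h0).inter ?_
  refine (measurableSet_le (h3.const_mul v₀) (h0.mul h2)).inter ?_
  exact measurableSet_le measurable_const h2

lemma BadI_bd {α c vs v₀ ε : ℝ} {D : ValueDist} (H : Ctx α c vs v₀ ε D) (n : ℕ) (i : Fin (n+1)) :
    (Measure.pi fun _ : Fin (n+1) => D.μ).real (BadI D c v₀ ((1 - ε/2) * (vs * D.q vs)) i) ≤
      Real.exp 1 * Real.exp (-(n * (kap α c * (ε * √ε)))) := by
  have := D.isProb
  apply fub D.μ n i _ (BadI_meas _ _ _ _ i) (by positivity)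
  intro v
  by_cases hv : 0 < v ∧ v * D.q v < (1 - ε/2) * (vs * D.q vs)
  · refine (measureReal_mono ?_).trans (fix_v H hv.1 hv.2 n)
    rintro t ⟨-, -, h3, h4⟩
    rw [Fin.insertNth_apply_same, cnt_insert] at h3 h4
    rw [cnt_insert] at h3
    have e : ind v v = 1 := by simp [ind]
    have e' := ind_nonneg v₀ v
    rw [e] at h3 h4
    have := H.hv₀
    push_cast at h4
    refine ⟨?_, by linarith⟩
    nlinarith
  · have : {t : Fin n → ℝ | (i.insertNth v t : Fin (n+1) → ℝ) ∈ BadI D c v₀ ((1 - ε/2) * (vs * D.q vs)) i} = ∅ := by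
      ext t
      simp only [mem_empty_iff_false, iff_false]
      rintro ⟨h1, h2, -, -⟩
      rw [Fin.insertNth_apply_same] at h1 h2
      exact hv ⟨h2, h1⟩
    rw [this]; simp; positivity

lemma good_pt {α c vs v₀ ε : ℝ} {D : ValueDist} (H : Ctx α c vs v₀ ε D) {m : ℕ} (hm : 0 < m)
    (s : Fin m → ℝ) {r : ℝ} (hr : IsGuardedEmpiricalReserve c s r) (hg : ¬ cnt s v₀ < c * m)
    (hb : ∀ i, s ∉ BadI D c v₀ ((1 - ε/2) * (vs * D.q vs)) i) :
    (1 - ε/2) * (vs * D.q vs) ≤ r * D.q r := by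
  obtain ⟨⟨i0, hi0⟩, h1, h2⟩ := hr
  simp only [cnt_eq] at h1 h2
  have hc := H.hc
  have hv₀ := H.hv₀
  have hmr : (0:ℝ) < m := by exact_mod_cast hm
  have hcm : 0 < c * m := by positivity
  have hpos : 0 < cnt s v₀ := by linarith
  obtain ⟨j1, hj1⟩ : ∃ j, v₀ ≤ s j := by
    by_contra hcon
    push Not at hcon
    have : cnt s v₀ = 0 := Finset.sum_eq_zero fun j _ => by simp [ind, hcon j]
    linarith
  obtain ⟨j, hj, hjm⟩ := Finset.exists_min_image (Finset.univ.filter fun j => v₀ ≤ s j) s ⟨j1, by simpa using hj1⟩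
  simp only [Finset.mem_filter, Finset.mem_univ, true_and] at hj hjm
  have hcj : cnt s (s j) = cnt s v₀ := by
    unfold cnt
    apply Finset.sum_congr rfl
    intro k _
    unfold ind
    have : s j ≤ s k ↔ v₀ ≤ s k := ⟨fun h => hj.trans h, fun h => hjm k h⟩
    simp [this]
  have h3 := h2 j (by rw [hcj]; linarith)
  have h4 : v₀ * cnt s v₀ ≤ r * cnt s r := by
    refine le_trans ?_ h3
    rw [hcj]; exact mul_le_mul_of_nonneg_right hj hpos.le
  have h5 : 0 < r := by
    have h6 : 0 < r * cnt s r := lt_of_lt_of_le (by positivity) h4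
    exact pos_of_mul_pos_left h6 (cnt_nonneg _ _)
  by_contra hcon
  push Not at hcon
  subst hi0
  exact hb i0 ⟨hcon, h5, h4, h1⟩

lemma ae_pos (D : ValueDist) (m : ℕ) : ∀ᵐ s ∂(Measure.pi fun _ : Fin m => D.μ), ∀ i, 0 < s i := by
  have := D.isProb
  rw [ae_all_iff]
  intro i
  have h : ∀ᵐ x ∂D.μ, 0 < x := by
    have : ∀ᵐ x ∂D.μ, x ∈ interior D.supp := D.I_full
    filter_upwards [this] with x hx
    exact D.I_pos hx
  exact (Measure.tendsto_eval_ae_ae (μ := fun _ : Fin m => D.μ) (i := i)).eventually h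

lemma rev_int (D : ValueDist) {vs : ℝ} (hmax : ∀ u, u * D.q u ≤ vs * D.q vs) {m : ℕ}
    {ER : (Fin m → ℝ) → ℝ} (hER : Measurable ER) (hs : ∀ s, ∃ i, ER s = s i) :
    (∀ᵐ s ∂(Measure.pi fun _ : Fin m => D.μ), 0 ≤ ER s * D.q (ER s)) ∧
    Integrable (fun s => ER s * D.q (ER s)) (Measure.pi fun _ : Fin m => D.μ) := by
  have := D.isProb
  have h0 : ∀ᵐ s ∂(Measure.pi fun _ : Fin m => D.μ), 0 ≤ ER s * D.q (ER s) := by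
    filter_upwards [ae_pos D m] with s h
    obtain ⟨i, hi⟩ := hs s
    rw [hi]
    exact mul_nonneg (h i).le (D.q_nonneg _)
  refine ⟨h0, Integrable.of_bound (hER.mul (D.q_cont.measurable.comp hER)).aestronglyMeasurable (vs * D.q vs) ?_⟩
  filter_upwards [h0] with s h
  rw [Real.norm_eq_abs, abs_of_nonneg h]
  exact hmax _

lemma int_lower (D : ValueDist) {vs : ℝ} (hmax : ∀ u, u * D.q u ≤ vs * D.q vs) {m : ℕ}
    {ER : (Fin m → ℝ) → ℝ} (hER : Measurable ER) (hs : ∀ s, ∃ i, ER s = s i) {G : Set (Fin m → ℝ)}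
    (hG : MeasurableSet G) {θ : ℝ} (hθ : ∀ s ∈ G, θ ≤ ER s * D.q (ER s)) :
    θ * (Measure.pi fun _ : Fin m => D.μ).real G ≤
      ∫ s, ER s * D.q (ER s) ∂(Measure.pi fun _ : Fin m => D.μ) := by
  have := D.isProb
  obtain ⟨h0, hi⟩ := rev_int D hmax hER hs
  have e : θ * (Measure.pi fun _ : Fin m => D.μ).real G = ∫ s, G.indicator (fun _ => θ) s ∂(Measure.pi fun _ : Fin m => D.μ) := by
    rw [integral_indicator_const _ hG]; simp [mul_comm]
  rw [e]
  apply integral_mono_ae ((integrable_const θ).indicator hG) hi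
  filter_upwards [h0] with s h
  by_cases hsG : s ∈ G
  · simp only [hsG, indicator_of_mem]; exact hθ s hsG
  · simp only [hsG, not_false_eq_true, indicator_of_notMem]; exact h

lemma mid_bound {α c vs v₀ ε : ℝ} {D : ValueDist} (H : Ctx α c vs v₀ ε D) (n : ℕ)
    {ER : (Fin (n+1) → ℝ) → ℝ} (hER : Measurable ER)
    (hs : ∀ s, IsGuardedEmpiricalReserve c s (ER s)) :
    (1 - ε/2) * (vs * D.q vs) * (1 - (n+2) * (Real.exp 1 * Real.exp (-(n * (kap α c * (ε * √ε)))))) ≤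
      ∫ s, ER s * D.q (ER s) ∂(Measure.pi fun _ : Fin (n+1) => D.μ) := by
  have := D.isProb
  set P := Measure.pi fun _ : Fin (n+1) => D.μ
  set θ := (1 - ε/2) * (vs * D.q vs) with hθ
  set e := Real.exp 1 * Real.exp (-(n * (kap α c * (ε * √ε)))) with he
  have hθ0 : 0 ≤ θ := mul_nonneg (by linarith [H.hε1]) (mul_nonneg H.hvs.le (D.q_nonneg _))
  set G0 : Set (Fin (n+1) → ℝ) := {s | cnt s v₀ < c * (n+1 : ℕ)}
  have hG0m : MeasurableSet G0 := measurableSet_lt (cnt_meas measurable_const) measurable_const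
  have hkp := kap_pos H.hα H.hα1 H.hc H.hc1
  have hε := H.hε
  have hG0 : P.real G0 ≤ e := by
    have h1c : 0 < 1 - c := by linarith [H.hc1]
    have hc := H.hc
    have hsp : 0 < √ε := Real.sqrt_pos.2 hε
    refine (guard_ok D H.hc H.hc1 (l := c * (1-c)/4 * √ε) (by positivity) H.hq₀ (n+1)).trans ?_
    rw [he]
    have k1 : kap α c ≤ (c * (1-c)/4)^2/8 := min_le_right _ _
    have hs1 : √ε ≤ 1 := Real.sqrt_le_one.2 H.hε1
    have k2 : kap α c * (ε * √ε) ≤ (c * (1-c)/4 * √ε)^2/8 := by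
      rw [mul_pow, Real.sq_sqrt hε.le]
      have : ε * √ε ≤ ε := mul_le_of_le_one_right hε.le hs1
      calc kap α c * (ε * √ε) ≤ (c * (1-c)/4)^2/8 * ε := mul_le_mul k1 this (by positivity) (by positivity)
        _ = _ := by ring
    have k3 : 0 ≤ kap α c * (ε * √ε) := by positivity
    apply mul_le_mul_of_nonneg_left _ (Real.exp_pos _).le
    apply Real.exp_le_exp.2
    push_cast
    have : (n:ℝ) * (kap α c * (ε * √ε)) ≤ n * ((c * (1-c)/4 * √ε)^2/8) := mul_le_mul_of_nonneg_left k2 (Nat.cast_nonneg _)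
    linarith
  set B := G0 ∪ ⋃ i, BadI D c v₀ θ i
  have hBm : MeasurableSet B := hG0m.union (MeasurableSet.iUnion fun i => BadI_meas _ _ _ _ i)
  have hB : P.real B ≤ (n+2) * e := by
    have h1 : P.real (⋃ i, BadI D c v₀ θ i) ≤ ∑ i, P.real (BadI D c v₀ θ i) := measureReal_iUnion_fintype_le _
    have h2 : ∑ i, P.real (BadI D c v₀ θ i) ≤ ∑ _i : Fin (n+1), e := Finset.sum_le_sum fun i _ => BadI_bd H n i
    have h3 : P.real B ≤ P.real G0 + P.real (⋃ i, BadI D c v₀ θ i) := measureReal_union_le _ _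
    simp at h2
    linarith
  have hl := int_lower D H.hmax hER (fun s => (hs s).1) hBm.compl (θ := θ) (fun s hsB => by
    have h1 : ¬ cnt s v₀ < c * (n+1 : ℕ) := fun h => hsB (Or.inl h)
    refine good_pt H (Nat.succ_pos n) s (hs s) h1 (fun i h => hsB (Or.inr (mem_iUnion.2 ⟨i, h⟩))))
  refine le_trans (mul_le_mul_of_nonneg_left ?_ hθ0) hl
  rw [probReal_compl_eq_one_sub hBm]
  linarith

lemma numerics {κ : ℝ} (hκ : 0 < κ) (hκ1 : κ ≤ 1) : ∃ C0 : ℝ, 0 < C0 ∧ ∀ ε : ℝ, 0 < ε → ε ≤ 1/2 → ∀ n : ℕ,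
    C0 * ε ^ (-(3:ℝ)/2) * Real.log (1/ε) ≤ (n:ℝ) + 1 →
    (n+2) * (Real.exp 1 * Real.exp (-(n * (κ * (ε * √ε))))) ≤ ε / 2 := by
  have hl2 : 0 < Real.log 2 := Real.log_pos (by norm_num)
  have he1 : 1 ≤ Real.exp 2 := Real.one_le_exp (by norm_num)
  have hK1 : 1 ≤ 8 * Real.exp 2 / κ := by rw [le_div_iff₀ hκ]; linarith
  obtain ⟨T, hT⟩ : ∃ T, T = Real.log (8 * Real.exp 2 / κ) / Real.log 2 := ⟨_, rfl⟩
  have hT0 : 0 ≤ T := by rw [hT]; exact div_nonneg (Real.log_nonneg hK1) hl2.le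
  refine ⟨(5 + 2 * T) / κ, by positivity, ?_⟩
  intro ε hε hε2 n hn
  obtain ⟨l, hl⟩ : ∃ l, l = Real.log (1/ε) := ⟨_, rfl⟩
  have hll : Real.log 2 ≤ l := by
    rw [hl]; apply Real.log_le_log (by norm_num)
    rw [le_div_iff₀ hε]; linarith
  have hεl : ε = Real.exp (-l) := by rw [hl, one_div, Real.log_inv, neg_neg, Real.exp_log hε]
  have hsl : √ε = Real.exp (-(l/2)) := by
    rw [hεl, Real.sqrt_eq_rpow, ← Real.exp_mul]; congr 1; ring
  have hes : ε * √ε = Real.exp (-(3/2*l)) := by rw [hsl, hεl, ← Real.exp_add]; congr 1; ring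
  have hpl : ε ^ (-(3:ℝ)/2) = Real.exp (3/2*l) := by
    rw [hεl, ← Real.exp_mul]; congr 1; ring
  rw [← hl, hpl] at hn
  obtain ⟨a, ha⟩ : ∃ a, a = κ * (ε * √ε) := ⟨_, rfl⟩
  rw [← ha]
  rw [hes] at ha
  have ha0 : 0 < a := by rw [ha]; positivity
  have ha1 : a ≤ 1 := by
    rw [ha]; apply mul_le_one₀ hκ1 (Real.exp_pos _).le
    rw [Real.exp_le_one_iff]; linarith
  have hma : (5 + 2 * T) * l ≤ ((n:ℝ)+1) * a := by
    have h := mul_le_mul_of_nonneg_right hn ha0.le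
    have e : (5 + 2*T)/κ * Real.exp (3/2*l) * l * a = (5 + 2*T) * l * (Real.exp (3/2*l) * Real.exp (-(3/2*l))) := by
      rw [ha]; field_simp
    rw [e, ← Real.exp_add] at h
    simpa using h
  have h1 : Real.exp (-(n*a)) ≤ Real.exp 1 * Real.exp (-(((n:ℝ)+1)*a)) := by
    rw [← Real.exp_add]; apply Real.exp_le_exp.2; linarith
  have h2 : ((n:ℝ)+1)*a/2 ≤ Real.exp (((n:ℝ)+1)*a/2) := by
    linarith [Real.add_one_le_exp (((n:ℝ)+1)*a/2)]
  have h3 : (n:ℝ)+2 ≤ 4 / a * Real.exp (((n:ℝ)+1)*a/2) := by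
    have : (n:ℝ)+1 ≤ 2 / a * Real.exp (((n:ℝ)+1)*a/2) := by
      rw [div_mul_eq_mul_div, le_div_iff₀ ha0]; linarith
    have e : 4 / a * Real.exp (((n:ℝ)+1)*a/2) = 2 * (2 / a * Real.exp (((n:ℝ)+1)*a/2)) := by ring
    have := Nat.cast_nonneg (α := ℝ) n
    rw [e]; linarith
  have h4 : Real.exp 1 * Real.exp (-(n*a)) ≤ Real.exp 2 * Real.exp (-(((n:ℝ)+1)*a)) := by
    calc _ ≤ Real.exp 1 * (Real.exp 1 * Real.exp (-(((n:ℝ)+1)*a))) := mul_le_mul_of_nonneg_left h1 (Real.exp_pos _).le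
      _ = _ := by rw [← mul_assoc, ← Real.exp_add]; norm_num
  have h5 : Real.exp (-(((n:ℝ)+1)*a/2)) ≤ Real.exp (-(5/2*l)) * (κ / (8 * Real.exp 2)) := by
    have e : κ / (8 * Real.exp 2) = Real.exp (-(T * Real.log 2)) := by
      rw [hT, div_mul_cancel₀ _ hl2.ne', ← Real.log_inv, Real.exp_log (by positivity), inv_div]
    rw [e, ← Real.exp_add]
    apply Real.exp_le_exp.2
    nlinarith
  calc (n+2) * (Real.exp 1 * Real.exp (-(n*a)))
      ≤ (4 / a * Real.exp (((n:ℝ)+1)*a/2)) * (Real.exp 2 * Real.exp (-(((n:ℝ)+1)*a))) :=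
        mul_le_mul h3 h4 (by positivity) (by positivity)
    _ = 4 * Real.exp 2 / a * Real.exp (-(((n:ℝ)+1)*a/2)) := by
        have : Real.exp (-(((n:ℝ)+1)*a/2)) = Real.exp (((n:ℝ)+1)*a/2) * Real.exp (-(((n:ℝ)+1)*a)) := by
          rw [← Real.exp_add]; congr 1; ring
        rw [this]; ring
    _ ≤ 4 * Real.exp 2 / a * (Real.exp (-(5/2*l)) * (κ / (8 * Real.exp 2))) := mul_le_mul_of_nonneg_left h5 (by positivity)
    _ = ε / 2 := by
        have e : Real.exp (-(5/2*l)) = Real.exp (-(3/2*l)) * ε := by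
          rw [hεl, ← Real.exp_add]; congr 1; ring
        rw [e, ha]
        field_simp
        norm_num

lemma kap_le {α c : ℝ} (hc : 0 < c) (hc1 : c < 1) : kap α c ≤ 1 := by
  have : kap α c ≤ c^2/24 := (min_le_left _ _).trans (min_le_right _ _)
  nlinarith

lemma crude (D : ValueDist) {c vs : ℝ} (hc : 0 < c) (hvs : 0 < vs) (hmax : ∀ u, u * D.q u ≤ vs * D.q vs)
    (hcs : c ≤ D.q vs) {m : ℕ} {ER : (Fin m → ℝ) → ℝ} (hER : Measurable ER) (hs : ∀ s, ∃ i, ER s = s i) :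
    (vs * D.q vs) / 2 * (c/2)^m ≤ ∫ s, ER s * D.q (ER s) ∂(Measure.pi fun _ : Fin m => D.μ) := by
  have := D.isProb
  have h2 : D.q (2*vs) ≤ D.q vs / 2 := by
    have := hmax (2*vs)
    have h : vs * (2 * D.q (2*vs)) ≤ vs * D.q vs := by linarith
    have := le_of_mul_le_mul_left h hvs
    linarith
  obtain ⟨w, hw, hqw⟩ := intermediate_value_Icc' (by linarith : vs ≤ 2*vs) D.q_cont.continuousOn
    (show D.q vs / 2 ∈ Icc (D.q (2*vs)) (D.q vs) from ⟨h2, by linarith⟩)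
  have hJ : c / 2 ≤ D.μ.real (Icc vs w) := by
    have h3 : D.μ.real (Ici vs) ≤ D.μ.real (Icc vs w) + D.μ.real (Ioi w) := by
      refine (measureReal_mono ?_).trans (measureReal_union_le _ _)
      intro x hx
      rcases le_or_gt x w with h | h
      · exact Or.inl ⟨hx, h⟩
      · exact Or.inr h
    rw [← D.q_eq', ← D.q_eq] at h3
    linarith
  set G : Set (Fin m → ℝ) := Set.univ.pi fun _ => Icc vs w
  have hG : MeasurableSet G := MeasurableSet.univ_pi fun _ => measurableSet_Icc
  have hPG : (Measure.pi fun _ : Fin m => D.μ).real G = (D.μ.real (Icc vs w))^m := by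
    rw [Measure.real, Measure.real, Measure.pi_pi, ENNReal.toReal_prod]
    simp
  have hρ : 0 ≤ vs * D.q vs / 2 := by have := D.q_nonneg vs; positivity
  have hl := int_lower D hmax hER hs hG (θ := vs * D.q vs / 2) (fun s hsG => by
    obtain ⟨i, hi⟩ := hs s
    have h := hsG i (mem_univ _)
    rw [hi]
    have : D.q w ≤ D.q (s i) := D.q_anti h.2
    have h0 := D.q_nonneg w
    calc vs * D.q vs / 2 = vs * D.q w := by rw [hqw]; ring
      _ ≤ s i * D.q (s i) := mul_le_mul h.1 this h0 (by linarith [h.1]))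
  refine le_trans (mul_le_mul_of_nonneg_left ?_ hρ) hl
  rw [hPG]
  exact pow_le_pow_left₀ (by positivity) hJ m

lemma middle {α : ℝ} (hα : 0 < α) (hα1 : α < 1) : ∃ C0 : ℝ, 0 < C0 ∧ ∀ ε : ℝ, 0 < ε → ε ≤ 1/2 →
    ∀ D : ValueDist, D.StronglyRegular α → ∀ vs, 0 < vs → (∀ u, u * D.q u ≤ vs * D.q vs) →
    (∀ u, (D.q u) ^ (1-α) * (1 + (1-α) * (u - vs) / vs) ≤ (D.q vs) ^ (1-α)) →
    ∀ m : ℕ, C0 * ε ^ (-(3:ℝ)/2) * Real.log (1/ε) ≤ (m:ℝ) →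
    ∀ ER : (Fin m → ℝ) → ℝ, Measurable ER →
        (∀ s, IsGuardedEmpiricalReserve (α ^ ((1:ℝ)/(1-α))) s (ER s)) →
     (1 - ε) * (vs * D.q vs) ≤ ∫ s, ER s * D.q (ER s) ∂(Measure.pi fun _ : Fin m => D.μ) := by
  obtain ⟨hc, hc1, hca⟩ := c_props hα hα1
  set c := α ^ ((1:ℝ)/(1-α))
  obtain ⟨C0, hC0, hnum⟩ := numerics (kap_pos hα hα1 hc hc1) (kap_le hc hc1)
  refine ⟨C0, hC0, ?_⟩
  intro ε hε hε2 D hD vs hvs hmax hkl m hm ER hER hs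
  rcases m with _ | n
  · exact (hs 0).1.choose.elim0
  have hcs := c_le hα1 hc hca D hvs hkl
  obtain ⟨v₀, hv₀, hq₀, hR₀⟩ := comparator hα hα1 hc hc1 hca D hD hvs hmax hkl hε (by linarith)
  have H : Ctx α c vs v₀ ε D := ⟨hα, hα1, hc, hc1, hvs, hmax, hkl, hcs, hε, by linarith, hv₀, hq₀, hR₀⟩
  have h1 := mid_bound H n hER hs
  push_cast at hm
  have h2 := hnum ε hε hε2 n hm
  refine le_trans ?_ h1
  have hρ : 0 ≤ vs * D.q vs := mul_nonneg hvs.le (D.q_nonneg _)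
  have h3 : 0 ≤ (1 - ε/2) * (vs * D.q vs) := mul_nonneg (by linarith) hρ
  refine le_trans ?_ (mul_le_mul_of_nonneg_left (show 1 - ε/2 ≤ _ by linarith) h3)
  nlinarith [mul_nonneg (sq_nonneg ε) hρ]

/-- For a fixed constant `α ∈ (0,1)` there is a constant `C_α` such that for every
`ε ∈ (0,1)`, every `α`-strongly regular value distribution `D`, and every
`m ≥ C_α ε^{-3/2} log(1/ε)`, the empirical reserve (guarded at `α^{1/(1-α)}`)
computed from `m` i.i.d. samples has expected revenue at least `(1-ε) R*`. -/
theorem strongly_regular_sample_complexity_upper_bound (α : ℝ) (hα : α ∈ Ioo (0:ℝ) 1) :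
    ∃ C : ℝ, 0 < C ∧
      ∀ ε : ℝ, ε ∈ Ioo (0:ℝ) 1 →
      ∀ D : ValueDist, D.StronglyRegular α →
      ∀ m : ℕ, C * ε ^ (-(3:ℝ)/2) * Real.log (1/ε) ≤ (m : ℝ) →
      ∀ ER : (Fin m → ℝ) → ℝ, Measurable ER →
        (∀ s, IsGuardedEmpiricalReserve (α ^ ((1:ℝ)/(1-α))) s (ER s)) →
      ∀ r : ℝ,
        (1 - ε) * (r * (1 - D.F r)) ≤
          ∫ s : Fin m → ℝ, ER s * (1 - D.F (ER s)) ∂(Measure.pi fun _ : Fin m => D.μ) := by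
  obtain ⟨hα0, hα1⟩ := hα
  obtain ⟨C0, hC0, hmid⟩ := middle hα0 hα1
  obtain ⟨hc, hc1, hca⟩ := c_props hα0 hα1
  obtain ⟨M, hM⟩ : ∃ M, M = C0 * (1/2:ℝ) ^ (-(3:ℝ)/2) * Real.log (1/(1/2)) := ⟨_, rfl⟩
  obtain ⟨A, hA⟩ : ∃ A, A = (α ^ ((1:ℝ)/(1-α)) / 2) ^ ⌈M⌉₊ := ⟨_, rfl⟩
  have hA0 : 0 < A := by rw [hA]; positivity
  have hM0 : 0 < M := by
    rw [hM]
    have : 0 < Real.log (1/(1/2)) := Real.log_pos (by norm_num)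
    positivity
  refine ⟨max C0 (2 * M / A), lt_max_of_lt_left hC0, ?_⟩
  intro ε hε D hD m hm ER hER hs r
  obtain ⟨hε0, hε1⟩ := hε
  change (1 - ε) * (r * D.q r) ≤ ∫ s, ER s * D.q (ER s) ∂(Measure.pi fun _ : Fin m => D.μ)
  obtain ⟨vs, hvs, hqs, hmax, hkl⟩ := D.key hα0 hα1 hD
  have hρ : 0 ≤ vs * D.q vs := mul_nonneg hvs.le (D.q_nonneg _)
  refine (mul_le_mul_of_nonneg_left (hmax r) (by linarith)).trans ?_
  have hlog : 0 < Real.log (1/ε) := Real.log_pos (by rw [lt_div_iff₀ hε0]; linarith)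
  have hp0 : 0 < ε ^ (-(3:ℝ)/2) := Real.rpow_pos_of_pos hε0 _
  have hX : 0 < ε ^ (-(3:ℝ)/2) * Real.log (1/ε) := mul_pos hp0 hlog
  rw [mul_assoc] at hm
  by_cases h2 : ε ≤ 1/2
  · refine hmid ε hε0 h2 D hD vs hvs hmax hkl m ?_ ER hER hs
    rw [mul_assoc]
    exact (mul_le_mul_of_nonneg_right (le_max_left _ _) hX.le).trans hm
  push Not at h2
  by_cases h3 : M ≤ m
  · refine le_trans ?_ (hmid (1/2) (by norm_num) le_rfl D hD vs hvs hmax hkl m (hM ▸ h3) ER hER hs)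
    exact mul_le_mul_of_nonneg_right (by linarith) hρ
  push Not at h3
  refine le_trans ?_ (crude D hc hvs hmax (c_le hα1 hc hca D hvs hkl) hER (fun s => (hs s).1))
  have h4 : A ≤ (α ^ ((1:ℝ)/(1-α)) / 2) ^ m := by
    rw [hA]
    apply pow_le_pow_of_le_one (by positivity) (by linarith)
    exact_mod_cast h3.le.trans (Nat.le_ceil M)
  have h5 : 1 - ε ≤ A / 2 := by
    have h6 : 1 - ε ≤ Real.log (1/ε) := by
      have := Real.one_sub_inv_le_log_of_pos (x := 1/ε) (by positivity)
      simpa using this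
    have h7 : 1 ≤ ε ^ (-(3:ℝ)/2) := Real.one_le_rpow_of_pos_of_le_one_of_nonpos hε0 hε1.le (by norm_num)
    have h8 : 1 - ε ≤ ε ^ (-(3:ℝ)/2) * Real.log (1/ε) := h6.trans (le_mul_of_one_le_left hlog.le h7)
    have h9 : 2 * M / A * (ε ^ (-(3:ℝ)/2) * Real.log (1/ε)) ≤ M :=
      ((mul_le_mul_of_nonneg_right (le_max_right _ _) hX.le).trans hm).trans h3.le
    have h10 : 2 * M / A * (1 - ε) ≤ M := (mul_le_mul_of_nonneg_left h8 (by positivity)).trans h9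
    rw [div_mul_eq_mul_div, div_le_iff₀ hA0] at h10
    have : M * (2 * (1 - ε)) ≤ M * A := by linarith
    have := le_of_mul_le_mul_left this hM0
    linarith
  calc (1 - ε) * (vs * D.q vs) ≤ A / 2 * (vs * D.q vs) := mul_le_mul_of_nonneg_right h5 hρ
    _ = vs * D.q vs / 2 * A := by ring
    _ ≤ _ := mul_le_mul_of_nonneg_left h4 (by linarith)
end
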